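/- arXiv:1901.04724 — 2 statements merged into one kernel-verified Lean document; each statement's English description precedes it below -/
import Mathlib

section
/- Let K, L ∈ ℕ with L > K, let α ∈ 𝒞_{K,L} with associated sequence (n_k), and let h(x) = -log x - log(1-x). There exists a constant C''' > 0 such that for every k ∈ ℕ and every s ∈ {1, …, q_{n_k}}: |S_{q_{n_k}}(h)(y_s) − c_k^h| < C''', where y_s is the midpoint of the interval I_s of the partition of 𝕋 by the points {−iα}_{i=0}^{q_{n_k}−1}, and c_k^h = S_{q_{n_k}}(h)(1/(2q_{n_k})). -/
open MeasureTheory Filter Topology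

noncomputable section

/-- Iterates of the Gauss map applied to the fractional part of `α`. -/
def gaussIter (α : ℝ) (n : ℕ) : ℝ := (fun x : ℝ => Int.fract x⁻¹)^[n] (Int.fract α)

/-- The `n`-th partial quotient `a_n` of the continued fraction expansion of `α`
(for `n ≥ 1`). -/
def cfA (α : ℝ) (n : ℕ) : ℕ := ⌊(gaussIter α (n - 1))⁻¹⌋₊

/-- The denominators `q_n` of the convergents of the continued fraction of `α`:
`q₀ = 1`, `q₁ = a₁`, `q_{n+1} = a_{n+1} q_n + q_{n-1}`. -/
def cfQ (α : ℝ) : ℕ → ℕ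
  | 0 => 1
  | 1 => cfA α 1
  | n + 2 => cfA α (n + 2) * cfQ α (n + 1) + cfQ α n

/-- Birkhoff sums over the rotation by `α`: `S_n(φ)(x) = ∑_{i<n} φ(x + iα)`. -/
def birkhoffRot (α : ℝ) (φ : ℝ → ℝ) (n : ℕ) (x : ℝ) : ℝ :=
  ∑ i ∈ Finset.range n, φ (x + i * α)

/-- Distance to the nearest integer, `‖x‖ = min(x mod 1, 1 - x mod 1)`. -/
def distNearestInt (x : ℝ) : ℝ := min (Int.fract x) (1 - Int.fract x)

/-- `h(x) = -log x - log(1-x)`, read on the circle. -/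
def symLog (x : ℝ) : ℝ := -Real.log (Int.fract x) - Real.log (1 - Int.fract x)

/-- The points `{-iα (mod 1)}_{0 ≤ i < q}` defining the partition of `𝕋 = [0,1)`. -/
def partPoints (α : ℝ) (q : ℕ) : Set ℝ :=
  (fun i : ℕ => Int.fract (-(i : ℝ) * α)) '' Set.Iio q

/-- `(v, w)` is one of the intervals of the partition of `𝕋 = [0,1)` by the points
`{-iα}_{0 ≤ i < q}`: `v` is a partition point, `w` is the next partition point
(or the endpoint `1`), and no partition point lies strictly between them. -/
def IsPartitionInterval (α : ℝ) (q : ℕ) (v w : ℝ) : Prop :=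
  v ∈ partPoints α q ∧ (w ∈ partPoints α q ∨ w = 1) ∧ v < w ∧
    ∀ p ∈ partPoints α q, ¬(v < p ∧ p < w)

section Residues

theorem injOn_affine_emod {q : ℕ} (hq : 0 < q) {p : ℤ} (hp : IsCoprime p (q : ℤ)) (g : ℤ) :
    Set.InjOn (fun i : ℕ => ((g + i * p) % (q : ℤ)).toNat) (Finset.range q : Set ℕ) := by
  intro i hi i' hi' h
  simp only [Finset.coe_range, Set.mem_Iio] at hi hi'
  have hq' : (0 : ℤ) < q := by exact_mod_cast hq
  have h1 := Int.emod_nonneg (g + i * p) hq'.ne'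
  have h2 := Int.emod_nonneg (g + i' * p) hq'.ne'
  have h3 : (g + i * p) % (q : ℤ) = (g + i' * p) % (q : ℤ) := by
    simp only at h; omega
  have h4 : (q : ℤ) ∣ ((i' : ℤ) - i) * p := by
    have := Int.ModEq.dvd (show g + i * p ≡ g + i' * p [ZMOD q] from h3)
    convert this using 1; ring
  have h5 : (q : ℤ) ∣ (i' : ℤ) - i := hp.symm.dvd_of_dvd_mul_right h4
  have h6 := Int.eq_zero_of_abs_lt_dvd h5 (by rw [abs_lt]; constructor <;> omega)
  omega

theorem mapsTo_affine_emod {q : ℕ} (hq : 0 < q) (p g : ℤ) :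
    Set.MapsTo (fun i : ℕ => ((g + i * p) % (q : ℤ)).toNat)
      (Finset.range q : Set ℕ) (Finset.range q : Set ℕ) := by
  intro i _
  have hq' : (0 : ℤ) < q := by exact_mod_cast hq
  have h1 := Int.emod_nonneg (g + i * p) hq'.ne'
  have h2 := Int.emod_lt_of_pos (g + i * p) hq'
  simp only [Finset.coe_range, Set.mem_Iio]
  omega

theorem surjOn_affine_emod {q : ℕ} (hq : 0 < q) {p : ℤ} (hp : IsCoprime p (q : ℤ)) (g : ℤ) :
    Set.SurjOn (fun i : ℕ => ((g + i * p) % (q : ℤ)).toNat)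
      (Finset.range q : Set ℕ) (Finset.range q : Set ℕ) :=
  Finset.surjOn_of_injOn_of_card_le _ (mapsTo_affine_emod hq p g) (injOn_affine_emod hq hp g) le_rfl

/-- An affine map with slope coprime to `q` permutes the residues modulo `q`. -/
theorem sum_affine_emod {q : ℕ} (hq : 0 < q) {p : ℤ} (hp : IsCoprime p (q : ℤ)) (g : ℤ)
    (f : ℕ → ℝ) :
    ∑ i ∈ Finset.range q, f ((g + i * p) % (q : ℤ)).toNat = ∑ r ∈ Finset.range q, f r :=
  Finset.sum_nbij _ (mapsTo_affine_emod hq p g) (injOn_affine_emod hq hp g)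
    (surjOn_affine_emod hq hp g) (fun _ _ => rfl)

theorem exists_eq_mul_add_emod {q : ℕ} (hq : 0 < q) (z : ℤ) :
    ∃ k : ℤ, (z : ℝ) = k * q + ((z % (q : ℤ)).toNat : ℝ) ∧ (z % (q : ℤ)).toNat < q ∧
      z = k * q + ((z % (q : ℤ)).toNat : ℤ) := by
  have hq' : (0 : ℤ) < q := by exact_mod_cast hq
  have h1 := Int.emod_nonneg z hq'.ne'
  have h2 := Int.emod_lt_of_pos z hq'
  have h3 : z = (z / q) * q + ((z % (q : ℤ)).toNat : ℤ) := by
    rw [Int.toNat_of_nonneg h1]; linarith [Int.emod_add_mul_ediv z q]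
  refine ⟨z / q, ?_, by omega, h3⟩
  exact_mod_cast h3

end Residues

section Sawtooth

theorem abs_fract_sub_grid_le {Q : ℕ} (hQ : 0 < Q) {r : ℕ} (hr : r < Q) {ε : ℝ}
    (h1 : -(1 / (Q : ℝ)) ≤ ε) (h2 : ε < 2 / Q) (k : ℤ) :
    |Int.fract (k + r / Q + ε) - (r / Q : ℝ)| ≤
      2 / Q + if r = 0 ∨ Q ≤ r + 2 then 1 else 0 := by
  have hQ' : (0 : ℝ) < Q := by exact_mod_cast hQ
  have hr0 : (0 : ℝ) ≤ r / Q := by positivity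
  have hr1 : (r / Q : ℝ) < 1 := by rw [div_lt_one hQ']; exact_mod_cast hr
  split_ifs with h
  · have := Int.fract_nonneg ((k : ℝ) + r / Q + ε)
    have := Int.fract_lt_one ((k : ℝ) + r / Q + ε)
    have : 0 < 2 / (Q : ℝ) := by positivity
    rw [abs_le]; constructor <;> linarith
  · have ha : (1 : ℝ) ≤ r := by exact_mod_cast (by omega : 1 ≤ r)
    have hb : (r : ℝ) + 3 ≤ Q := by exact_mod_cast (by omega : r + 3 ≤ Q)
    have ha' : 1 / (Q : ℝ) ≤ r / Q := by gcongr
    have hb' : (r : ℝ) / Q + 3 / Q ≤ 1 := by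
      rw [← add_div, div_le_one hQ']; exact hb
    have h3 : 2 / (Q : ℝ) ≤ 3 / Q := by gcongr; norm_num
    have h12 : 1 / (Q : ℝ) ≤ 2 / Q := by gcongr; norm_num
    have : Int.fract ((k : ℝ) + r / Q + ε) = r / Q + ε := by
      rw [Int.fract_eq_iff]
      exact ⟨by linarith, by linarith, k, by ring⟩
    rw [this, add_sub_cancel_left, add_zero, abs_le]
    constructor <;> linarith

/-- A Denjoy–Koksma bound for the sawtooth function. -/
theorem abs_sum_sawtooth_le {Q : ℕ} (hQ : 0 < Q) {P : ℤ} (hP : IsCoprime P (Q : ℤ)) {β : ℝ}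
    (hβ : |β - P / Q| ≤ 1 / (Q : ℝ) ^ 2) (γ : ℝ) :
    |∑ l ∈ Finset.range Q, (Int.fract (γ + l * β) - 1 / 2)| ≤ 6 := by
  have hQ' : (0 : ℝ) < Q := by exact_mod_cast hQ
  set g : ℤ := ⌊γ * Q⌋
  have hg1 := Int.floor_le (γ * Q)
  have hg2 := Int.lt_floor_add_one (γ * Q)
  have key : ∀ l ∈ Finset.range Q,
      |Int.fract (γ + l * β) - ((((g + l * P) % (Q : ℤ)).toNat : ℕ) : ℝ) / Q| ≤
        2 / Q + if ((g + l * P) % (Q : ℤ)).toNat = 0 ∨ Q ≤ ((g + l * P) % (Q : ℤ)).toNat + 2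
          then 1 else 0 := by
    intro l hl
    obtain ⟨k, hk, hr, -⟩ := exists_eq_mul_add_emod hQ (g + l * P)
    set r := ((g + l * P) % (Q : ℤ)).toNat
    have hl' : (l : ℝ) ≤ Q := by exact_mod_cast (Finset.mem_range.1 hl).le
    have hη : |(l : ℝ) * (β - P / Q)| ≤ 1 / Q := by
      rw [abs_mul, Nat.abs_cast]
      calc (l : ℝ) * |β - P / Q| ≤ Q * (1 / (Q : ℝ) ^ 2) := by gcongr
        _ = 1 / Q := by field_simp
    rw [abs_le] at hη
    have hθ1 : 0 ≤ γ - g / Q := by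
      rw [sub_nonneg, div_le_iff₀ hQ']; exact hg1
    have hθ2 : γ - g / Q < 1 / Q := by
      rw [sub_lt_iff_lt_add, ← add_div, lt_div_iff₀ hQ']; linarith
    have h := abs_fract_sub_grid_le hQ hr (ε := (γ - g / Q) + l * (β - P / Q))
      (by linarith) (by
        have : 2 / (Q : ℝ) = 1 / Q + 1 / Q := by ring
        linarith) k
    have e : (k : ℝ) + r / Q + ((γ - g / Q) + l * (β - P / Q)) = γ + l * β := by
      push_cast at hk
      have : (r : ℝ) = g + l * P - k * Q := by linarith
      rw [this]; field_simp; ring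
    rwa [e] at h
  have hsum := (Finset.abs_sum_le_sum_abs _ _).trans (Finset.sum_le_sum key)
  rw [Finset.sum_sub_distrib, Finset.sum_add_distrib,
    sum_affine_emod hQ hP g (fun r => (r : ℝ) / Q),
    sum_affine_emod hQ hP g (fun r => if r = 0 ∨ Q ≤ r + 2 then (1 : ℝ) else 0)] at hsum
  have hbad : ∑ r ∈ Finset.range Q, (if r = 0 ∨ Q ≤ r + 2 then (1 : ℝ) else 0) ≤ 3 := by
    rw [Finset.sum_boole]
    have : (Finset.range Q).filter (fun r => r = 0 ∨ Q ≤ r + 2) ⊆ {0, Q - 1, Q - 2} := by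
      intro r hr
      simp only [Finset.mem_filter, Finset.mem_range, Finset.mem_insert,
        Finset.mem_singleton] at hr ⊢
      omega
    exact_mod_cast (Finset.card_le_card this).trans Finset.card_le_three
  have hgrid : ∑ r ∈ Finset.range Q, (r : ℝ) / Q = (Q - 1) / 2 := by
    rw [← Finset.sum_div]
    have := Finset.sum_range_id_mul_two Q
    have h2 : (∑ r ∈ Finset.range Q, (r : ℝ)) * 2 = Q * (Q - 1) := by
      rw [← Nat.cast_sum, ← Nat.cast_pred hQ]; exact_mod_cast this
    field_simp; linarith
  have hconst : ∑ _r ∈ Finset.range Q, 2 / (Q : ℝ) = 2 := by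
    simp only [Finset.sum_const, Finset.card_range, nsmul_eq_mul]; field_simp
  rw [hgrid, hconst, abs_le] at hsum
  rw [Finset.sum_sub_distrib, abs_le]
  simp only [Finset.sum_const, Finset.card_range, nsmul_eq_mul]
  constructor <;> linarith [hsum.1, hsum.2]

end Sawtooth

section Continuants

/-- Denominators of the convergents of the continued fraction with partial quotients `b`. -/
def contDen (b : ℕ → ℕ) : ℕ → ℕ
  | 0 => 1
  | 1 => b 1
  | n + 2 => b (n + 2) * contDen b (n + 1) + contDen b n

/-- Numerators of the convergents of the continued fraction with partial quotients `b`. -/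
def contNum (b : ℕ → ℕ) : ℕ → ℕ
  | 0 => 0
  | 1 => 1
  | n + 2 => b (n + 2) * contNum b (n + 1) + contNum b n

theorem contDen_add_two (b : ℕ → ℕ) (n : ℕ) :
    contDen b (n + 2) = b (n + 2) * contDen b (n + 1) + contDen b n := rfl

theorem contNum_add_two (b : ℕ → ℕ) (n : ℕ) :
    contNum b (n + 2) = b (n + 2) * contNum b (n + 1) + contNum b n := rfl

theorem contNum_mul_contDen_sub (b : ℕ → ℕ) (n : ℕ) :
    (contNum b (n + 1) : ℤ) * contDen b n - contNum b n * contDen b (n + 1) = (-1) ^ n := by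
  induction n with
  | zero => simp [contNum, contDen]
  | succ n ih =>
    rw [contDen_add_two, contNum_add_two, pow_succ, ← ih]; push_cast; ring

theorem isCoprime_contNum_contDen (b : ℕ → ℕ) (n : ℕ) :
    IsCoprime (contNum b n : ℤ) (contDen b n : ℤ) := by
  have h := contNum_mul_contDen_sub b n
  have h2 : ((-1 : ℤ) ^ n) * (-1) ^ n = 1 := by rw [← mul_pow]; simp
  refine ⟨-(-1) ^ n * contDen b (n + 1), (-1) ^ n * contNum b (n + 1), ?_⟩
  linear_combination (-1) ^ n * h + h2

variable {b : ℕ → ℕ}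

theorem contDen_pos (hb : ∀ i, 1 ≤ b i) (n : ℕ) : 0 < contDen b n := by
  induction n using Nat.twoStepInduction with
  | zero => simp [contDen]
  | one => exact hb 1
  | more n ih _ => rw [contDen_add_two]; omega

theorem contDen_le_succ (hb : ∀ i, 1 ≤ b i) (n : ℕ) : contDen b n ≤ contDen b (n + 1) := by
  cases n with
  | zero => exact hb 1
  | succ n =>
    rw [contDen_add_two]
    exact (Nat.le_mul_of_pos_left _ (hb _)).trans (Nat.le_add_right _ _)

theorem two_mul_contDen_le (hb : ∀ i, 1 ≤ b i) (n : ℕ) :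
    2 * contDen b n ≤ contDen b (n + 2) := by
  have h1 := contDen_le_succ hb n
  have h2 := Nat.le_mul_of_pos_left (contDen b (n + 1)) (hb (n + 2))
  rw [contDen_add_two]; omega

theorem contDen_succ_le (hb : ∀ i, 1 ≤ b i) (n : ℕ) :
    contDen b (n + 1) ≤ (b (n + 1) + 1) * contDen b n := by
  cases n with
  | zero => simp [contDen]
  | succ n =>
    have := contDen_le_succ hb n
    rw [contDen_add_two]; linarith

theorem mul_contDen_le_succ (b : ℕ → ℕ) (n : ℕ) :
    b (n + 1) * contDen b n ≤ contDen b (n + 1) := by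
  cases n with
  | zero => simp [contDen]
  | succ n => rw [contDen_add_two]; exact Nat.le_add_right _ _

/-- Splitting a continuant into a reversed final part and an initial part. -/
theorem contDen_eq_reverse_add (a : ℕ → ℕ) (n m s : ℕ) (h : m + s + 2 = n) :
    contDen a n = contDen (fun i => a (n + 1 - i)) (m + 1) * contDen a (s + 1) +
      contDen (fun i => a (n + 1 - i)) m * contDen a s := by
  induction m generalizing s with
  | zero =>
    subst h
    simp [contDen]
  | succ m ih =>
    rw [ih (s + 1) (by omega), contDen_add_two _ m, contDen_add_two a s,
      show n + 1 - (m + 2) = s + 2 by omega]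
    ring

theorem contDen_reverse (a : ℕ → ℕ) (n : ℕ) :
    contDen (fun i => a (n + 1 - i)) n = contDen a n := by
  match n with
  | 0 => rfl
  | 1 => simp [contDen]
  | n + 2 =>
    rw [contDen_eq_reverse_add a (n + 2) n 0 rfl, contDen_add_two]
    simp only [show n + 2 + 1 - (n + 2) = 1 by omega]
    simp [contDen]; ring

theorem contDen_mul_reverse_sub (a : ℕ → ℕ) (n m s : ℕ) (h : m + s + 1 = n) :
    (contDen a (n - 1) : ℤ) * contDen (fun i => a (n + 1 - i)) m -
      contDen a n * contNum (fun i => a (n + 1 - i)) m = (-1) ^ m * contDen a s := by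
  induction m using Nat.twoStepInduction generalizing s with
  | zero => subst h; simp [contDen, contNum]
  | one =>
    subst h
    simp [contDen, contNum, show 1 + s = s + 1 by omega, show s + 1 + 1 = s + 2 from rfl]
    ring
  | more m ih1 ih2 =>
    have e1 := ih1 (s + 2) (by omega)
    have e2 := ih2 (s + 1) (by omega)
    rw [contDen_add_two _ m, contNum_add_two _ m]
    have e3 : n + 1 - (m + 2) = s + 2 := by omega
    simp only [e3]
    have e4 := contDen_add_two a s
    push_cast
    have e5 : (contDen a (s + 2) : ℤ) = a (s + 2) * contDen a (s + 1) + contDen a s := by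
      exact_mod_cast e4
    rw [e5] at e1
    rw [pow_succ] at e2
    rw [pow_succ, pow_succ]
    linear_combination (a (s + 2) : ℤ) * e2 + e1

theorem contDen_mul_reverse_le {a : ℕ → ℕ} (ha : ∀ i, 1 ≤ a i) (n m s : ℕ) (h : m + s + 1 = n) :
    contDen a s * contDen (fun i => a (n + 1 - i)) m ≤ contDen a n := by
  cases m with
  | zero =>
    have : n = s + 1 := by omega
    subst this
    simpa [contDen] using contDen_le_succ ha s
  | succ m =>
    rw [contDen_eq_reverse_add a n m s (by omega)]
    nlinarith [contDen_le_succ ha s]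

/-- The convergents of the reversed continued fraction approximate `q_{n-1} / q_n`. -/
theorem abs_reverse_sub_le {a : ℕ → ℕ} (ha : ∀ i, 1 ≤ a i) (n m : ℕ) (h : m < n) :
    |(contDen a (n - 1) / contDen a n : ℝ) -
        contNum (fun i => a (n + 1 - i)) m / contDen (fun i => a (n + 1 - i)) m| ≤
      1 / (contDen (fun i => a (n + 1 - i)) m : ℝ) ^ 2 := by
  obtain ⟨s, hs⟩ : ∃ s, m + s + 1 = n := ⟨n - m - 1, by omega⟩
  have hQ : (0 : ℝ) < contDen (fun i => a (n + 1 - i)) m := by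
    exact_mod_cast contDen_pos (fun i => ha _) m
  have hq : (0 : ℝ) < contDen a n := by exact_mod_cast contDen_pos ha n
  have e : (contDen a (n - 1) : ℝ) * contDen (fun i => a (n + 1 - i)) m -
      contDen a n * contNum (fun i => a (n + 1 - i)) m = (-1) ^ m * contDen a s := by
    exact_mod_cast contDen_mul_reverse_sub a n m s hs
  have l : (contDen a s : ℝ) * contDen (fun i => a (n + 1 - i)) m ≤ contDen a n := by
    exact_mod_cast contDen_mul_reverse_le ha n m s hs
  rw [div_sub_div _ _ hq.ne' hQ.ne', e, abs_div, abs_mul, abs_pow, abs_neg, abs_one, one_pow,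
    one_mul, Nat.abs_cast, abs_of_pos (mul_pos hq hQ), div_le_div_iff₀ (mul_pos hq hQ) (by positivity)]
  nlinarith

end Continuants

section Discrepancy

/-- Partial sums of the sawtooth function along a rotation orbit. -/
def sawSum (β γ : ℝ) (N : ℕ) : ℝ := ∑ l ∈ Finset.range N, (Int.fract (γ + l * β) - 1 / 2)

theorem sawSum_add (β γ : ℝ) (M N : ℕ) :
    sawSum β γ (M + N) = sawSum β γ M + sawSum β (γ + M * β) N := by
  unfold sawSum
  rw [Finset.sum_range_add]
  congr 1
  refine Finset.sum_congr rfl fun l _ => ?_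
  push_cast; ring_nf

theorem abs_fract_sub_half_le (x : ℝ) : |Int.fract x - 1 / 2| ≤ 1 / 2 := by
  have := Int.fract_nonneg x
  have := Int.fract_lt_one x
  rw [abs_le]; constructor <;> linarith

theorem abs_sawSum_le_half_mul (β γ : ℝ) (N : ℕ) : |sawSum β γ N| ≤ N / 2 := by
  refine (Finset.abs_sum_le_sum_abs _ _).trans
    ((Finset.sum_le_sum fun l _ => abs_fract_sub_half_le _).trans ?_)
  simp only [Finset.sum_const, Finset.card_range, nsmul_eq_mul]
  linarith

theorem abs_sawSum_block_le {β : ℝ} {Q : ℕ} (hQ : ∀ γ, |sawSum β γ Q| ≤ 6) (r N : ℕ) (γ : ℝ)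
    {B : ℝ} (hB : ∀ γ, |sawSum β γ N| ≤ B) : |sawSum β γ (r * Q + N)| ≤ 6 * r + B := by
  induction r generalizing γ with
  | zero => simpa using hB γ
  | succ r ih =>
    rw [show (r + 1) * Q + N = Q + (r * Q + N) by ring, sawSum_add]
    refine (abs_add_le _ _).trans ?_
    have := ih (γ + Q * β)
    have := hQ γ
    push_cast; linarith

theorem abs_sawSum_le {β : ℝ} {Q : ℕ → ℕ} (hQ0 : Q 0 = 1) (hpos : ∀ m, 0 < Q m) (m : ℕ)
    (hQ : ∀ i ≤ m, ∀ γ, |sawSum β γ (Q i)| ≤ 6) (N : ℕ) (hN : N ≤ Q (m + 1)) (γ : ℝ) :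
    |sawSum β γ N| ≤ 6 * (∑ i ∈ Finset.range m, (Q (i + 1) : ℝ) / Q i + (N : ℝ) / Q m) := by
  induction m generalizing N γ with
  | zero =>
    have := abs_sawSum_le_half_mul β γ N
    have : (0 : ℝ) ≤ N := by positivity
    simp only [hQ0, Finset.range_zero, Finset.sum_empty, Nat.cast_one, div_one, zero_add]
    linarith
  | succ m ih =>
    have hp : (0 : ℝ) < Q (m + 1) := by exact_mod_cast hpos (m + 1)
    have hp' : (0 : ℝ) < Q m := by exact_mod_cast hpos m
    have hmod := (Nat.mod_lt N (hpos (m + 1))).le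
    have h1 := abs_sawSum_block_le (hQ (m + 1) le_rfl) (N / Q (m + 1)) (N % Q (m + 1)) γ
      (B := 6 * (∑ i ∈ Finset.range m, (Q (i + 1) : ℝ) / Q i + (Q (m + 1) : ℝ) / Q m))
      (fun γ => (ih (fun i hi => hQ i (by omega)) _ hmod γ).trans (by gcongr))
    rw [Nat.div_add_mod' N (Q (m + 1))] at h1
    have h2 : ((N / Q (m + 1) : ℕ) : ℝ) ≤ (N : ℝ) / Q (m + 1) := Nat.cast_div_le
    rw [Finset.sum_range_succ]
    linarith

theorem sum_div_succ_half_eq (g : ℕ → ℝ) (N : ℕ) :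
    ∑ l ∈ Finset.range N, g l / (l + 1 / 2) =
      (∑ l ∈ Finset.range N, g l) / (N + 1 / 2) +
        ∑ l ∈ Finset.range N, (∑ i ∈ Finset.range (l + 1), g i) *
          (1 / ((l : ℝ) + 1 / 2) - 1 / (l + 3 / 2)) := by
  induction N with
  | zero => simp
  | succ N ih =>
    rw [Finset.sum_range_succ, ih, Finset.sum_range_succ _ N, Finset.sum_range_succ _ N]
    have h1 : (N : ℝ) + 1 / 2 ≠ 0 := by positivity
    have h2 : (N : ℝ) + 3 / 2 ≠ 0 := by positivity
    rw [Finset.sum_range_succ _ N]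
    push_cast
    rw [show (N : ℝ) + 1 + 1 / 2 = N + 3 / 2 by ring]
    field_simp
    ring

theorem abs_weighted_sawtooth_le (β γ : ℝ) (N : ℕ) :
    |∑ l ∈ Finset.range N, (Int.fract (γ + l * β) - 1 / 2) / ((l : ℝ) + 1 / 2)| ≤
      1 + 2 * ∑ l ∈ Finset.range N, |sawSum β γ (l + 1)| / ((l : ℝ) + 1) ^ 2 := by
  rw [sum_div_succ_half_eq]
  refine (abs_add_le _ _).trans (add_le_add ?_ ?_)
  · rw [abs_div, abs_of_pos (show (0 : ℝ) < N + 1 / 2 by positivity),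
      div_le_one (by positivity)]
    have := abs_sawSum_le_half_mul β γ N
    unfold sawSum at this
    have : (0 : ℝ) ≤ N := by positivity
    linarith
  · rw [Finset.mul_sum]
    refine (Finset.abs_sum_le_sum_abs _ _).trans (Finset.sum_le_sum fun l _ => ?_)
    rw [abs_mul]
    have hl : (0 : ℝ) ≤ l := by positivity
    have : (1 / ((l : ℝ) + 1 / 2) - 1 / (l + 3 / 2)) = 1 / (((l : ℝ) + 1 / 2) * (l + 3 / 2)) := by
      field_simp; ring
    rw [this, abs_of_pos (a := 1 / (((l : ℝ) + 1 / 2) * (l + 3 / 2))) (by positivity),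
      mul_div_assoc', mul_one,
      mul_div_assoc', div_le_div_iff₀ (by positivity) (by positivity)]
    have h0 : 0 ≤ |sawSum β γ (l + 1)| := abs_nonneg _
    change |sawSum β γ (l + 1)| * _ ≤ _
    nlinarith [mul_nonneg h0 hl, mul_nonneg (mul_nonneg h0 hl) hl]

theorem sum_Ico_inv_sq_le {A B : ℕ} (hA : 0 < A) (hAB : A ≤ B) :
    ∑ l ∈ Finset.Ico A B, 1 / ((l : ℝ) + 1) ^ 2 ≤ 1 / (A : ℝ) - 1 / (B : ℝ) := by
  induction B, hAB using Nat.le_induction with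
  | base => simp
  | succ B hB ih =>
    rw [Finset.sum_Ico_succ_top hB]
    have hB' : (0 : ℝ) < B := by exact_mod_cast hA.trans_le hB
    have : 1 / ((B : ℝ) + 1) ^ 2 ≤ 1 / B - 1 / (B + 1) := by
      rw [div_sub_div _ _ hB'.ne' (by positivity), div_le_div_iff₀ (by positivity) (by positivity)]
      nlinarith
    push_cast; linarith

theorem sum_Ico_inv_le {A B : ℕ} (hA : 0 < A) (hAB : A ≤ B) :
    ∑ l ∈ Finset.Ico A B, 1 / ((l : ℝ) + 1) ≤ Real.log (B / A) := by
  have hA' : (0 : ℝ) < A := by exact_mod_cast hA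
  induction B, hAB using Nat.le_induction with
  | base => simp [hA'.ne']
  | succ B hB ih =>
    rw [Finset.sum_Ico_succ_top hB]
    have hB' : (0 : ℝ) < B := by exact_mod_cast hA.trans_le hB
    have h := Real.one_sub_inv_le_log_of_pos (show (0 : ℝ) < (B + 1) / B by positivity)
    rw [Real.log_div (by positivity) (by positivity)] at h ih ⊢
    have : 1 - (((B : ℝ) + 1) / B)⁻¹ = 1 / (B + 1) := by field_simp; ring
    push_cast; linarith

theorem sum_range_le_of_halving {f g : ℕ → ℝ} {G : ℝ} (hf : ∀ j, 0 ≤ f j)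
    (h : ∀ j, f (j + 2) ≤ f j / 2 + g j) (hG : ∀ m, ∑ j ∈ Finset.range m, g j ≤ G) (m : ℕ) :
    ∑ j ∈ Finset.range m, f j ≤ 2 * (f 0 + f 1 + G) := by
  have h1 : ∑ j ∈ Finset.range m, f j ≤ ∑ j ∈ Finset.range (m + 2), f j :=
    Finset.sum_le_sum_of_subset_of_nonneg (Finset.range_mono (by omega)) fun i _ _ => hf i
  have h2 : ∑ j ∈ Finset.range m, f (j + 2) ≤
      (∑ j ∈ Finset.range m, f j) / 2 + ∑ j ∈ Finset.range m, g j := by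
    rw [Finset.sum_div, ← Finset.sum_add_distrib]
    exact Finset.sum_le_sum fun j _ => h j
  rw [Finset.sum_range_succ', Finset.sum_range_succ'] at h1
  simp only [zero_add] at h1
  have := hG m
  have e : ∑ k ∈ Finset.range m, f (k + 1 + 1) = ∑ j ∈ Finset.range m, f (j + 2) := rfl
  linarith

variable {b : ℕ → ℕ}

theorem div_contDen_add_two_le (hb : ∀ i, 1 ≤ b i) (j : ℕ) {x : ℝ} (hx : 0 ≤ x) :
    x / contDen b (j + 2) ≤ x / contDen b j / 2 := by
  have h0 : (0 : ℝ) < contDen b j := by exact_mod_cast contDen_pos hb j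
  have h1 : (2 : ℝ) * contDen b j ≤ contDen b (j + 2) := by exact_mod_cast two_mul_contDen_le hb j
  rw [div_div]
  gcongr
  linarith

theorem sum_inv_contDen_le (hb : ∀ i, 1 ≤ b i) (m : ℕ) :
    ∑ j ∈ Finset.range m, 1 / (contDen b j : ℝ) ≤ 4 := by
  have h1 : (1 : ℝ) ≤ contDen b 1 := by exact_mod_cast contDen_pos hb 1
  have := sum_range_le_of_halving (f := fun j => 1 / (contDen b j : ℝ)) (g := fun _ => 0) (G := 0)
    (fun j => by positivity) (fun j => by
      simpa using div_contDen_add_two_le hb j zero_le_one) (by simp) m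
  have h2 : 1 / (contDen b 1 : ℝ) ≤ 1 := by rw [div_le_one (by linarith)]; exact h1
  have h3 : 1 / (contDen b 0 : ℝ) = 1 := by simp [contDen]
  simp only [h3] at this
  linarith

theorem sum_id_div_contDen_le (hb : ∀ i, 1 ≤ b i) (m : ℕ) :
    ∑ j ∈ Finset.range m, (j : ℝ) / contDen b j ≤ 10 := by
  have h1 : (1 : ℝ) ≤ contDen b 1 := by exact_mod_cast contDen_pos hb 1
  have := sum_range_le_of_halving (f := fun j => (j : ℝ) / (contDen b j : ℝ))
    (g := fun j => 1 / (contDen b j : ℝ)) (G := 4)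
    (fun j => by positivity) (fun j => by
      have := div_contDen_add_two_le hb j (x := (j : ℝ) + 2) (by positivity)
      push_cast
      refine this.trans (le_of_eq ?_)
      ring) (sum_inv_contDen_le hb) m
  have h2 : 1 / (contDen b 1 : ℝ) ≤ 1 := by rw [div_le_one (by linarith)]; exact h1
  simp only [Nat.cast_zero, zero_div, Nat.cast_one] at this
  linarith

theorem sum_ratio_div_contDen_le (hb : ∀ i, 1 ≤ b i) (m : ℕ) :
    ∑ j ∈ Finset.range m,
      (∑ i ∈ Finset.range j, (contDen b (i + 1) : ℝ) / contDen b i) / contDen b j ≤ 18 := by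
  have hp : ∀ j, (0 : ℝ) < contDen b j := fun j => by exact_mod_cast contDen_pos hb j
  have hm : ∀ j, (contDen b j : ℝ) ≤ contDen b (j + 1) := fun j => by
    exact_mod_cast contDen_le_succ hb j
  have := sum_range_le_of_halving
    (f := fun j => (∑ i ∈ Finset.range j, (contDen b (i + 1) : ℝ) / contDen b i) / contDen b j)
    (g := fun j => 2 * (1 / (contDen b j : ℝ))) (G := 2 * 4)
    (fun j => by positivity) (fun j => by
      rw [Finset.sum_range_succ, Finset.sum_range_succ, add_div, add_div]
      have h1 := div_contDen_add_two_le hb j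
        (x := ∑ i ∈ Finset.range j, (contDen b (i + 1) : ℝ) / contDen b i) (by positivity)
      have h2 : (contDen b (j + 1) : ℝ) / contDen b j / contDen b (j + 2) ≤ 1 / contDen b j := by
        rw [div_right_comm]
        have : (contDen b (j + 1) : ℝ) / contDen b (j + 2) ≤ 1 := by
          rw [div_le_one (hp _)]; exact hm _
        have := hp j
        gcongr
      have h3 : (contDen b (j + 2) : ℝ) / contDen b (j + 1) / contDen b (j + 2) ≤
          1 / contDen b j := by
        rw [div_right_comm, div_self (hp _).ne']
        exact one_div_le_one_div_of_le (hp _) (hm _)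
      change _ + (contDen b (j + 2) : ℝ) / contDen b (j + 1) / contDen b (j + 2) ≤ _
      linarith)
    (fun m => by
      rw [← Finset.mul_sum]
      have := sum_inv_contDen_le hb m
      linarith) m
  simp only [Finset.range_zero, Finset.sum_empty, zero_div, Finset.sum_range_one, zero_add] at this
  have h0 : (contDen b 1 : ℝ) / contDen b 0 / contDen b 1 = 1 := by
    rw [show contDen b 0 = 1 from rfl, Nat.cast_one, div_one, div_self (hp 1).ne']
  rw [h0] at this
  linarith

theorem log_contDen_ratio_le (hb : ∀ i, 1 ≤ b i) {m : ℕ} {t : ℝ} (ht : 0 ≤ t)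
    (h : (b (m + 1) : ℝ) ≤ Real.exp t) :
    Real.log (contDen b (m + 1) / contDen b m) ≤ 1 + t := by
  have hp : ∀ j, (0 : ℝ) < contDen b j := fun j => by exact_mod_cast contDen_pos hb j
  have h1 : (contDen b (m + 1) : ℝ) / contDen b m ≤ b (m + 1) + 1 := by
    rw [div_le_iff₀ (hp m)]; exact_mod_cast contDen_succ_le hb m
  have h2 : (1 : ℝ) ≤ Real.exp t := Real.one_le_exp ht
  have h3 : (2 : ℝ) ≤ Real.exp 1 := by linarith [Real.add_one_le_exp (1 : ℝ)]
  rw [Real.log_le_iff_le_exp (div_pos (hp _) (hp _)), Real.exp_add]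
  nlinarith

theorem sum_sawSum_div_sq_le (hb : ∀ i, 1 ≤ b i) {c : ℝ} (hc : 0 < c) {n : ℕ}
    (hexp : ∀ m, 1 ≤ m → m ≤ n → (b m : ℝ) ≤ Real.exp (c * m)) {β : ℝ}
    (hβ : ∀ m < n, ∀ γ, |sawSum β γ (contDen b m)| ≤ 6) (γ : ℝ) :
    ∑ l ∈ Finset.range (contDen b n), |sawSum β γ (l + 1)| / ((l : ℝ) + 1) ^ 2 ≤
      1 / 2 + 6 * (18 + 4 * (1 + c) + 10 * c) := by
  have hp : ∀ j, (0 : ℝ) < contDen b j := fun j => by exact_mod_cast contDen_pos hb j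
  have key : ∀ k ≤ n,
      ∑ l ∈ Finset.range (contDen b k), |sawSum β γ (l + 1)| / ((l : ℝ) + 1) ^ 2 ≤
      1 / 2 + ∑ m ∈ Finset.range k, 6 *
        ((∑ i ∈ Finset.range m, (contDen b (i + 1) : ℝ) / contDen b i) / contDen b m +
          (1 + c) * (1 / (contDen b m : ℝ)) + c * ((m : ℝ) / contDen b m)) := by
    intro k hk
    induction k with
    | zero =>
      have := abs_sawSum_le_half_mul β γ 1
      simpa [contDen] using this
    | succ k ih =>
      have hle := contDen_le_succ hb k
      rw [Finset.sum_range_succ _ k, ← Finset.sum_range_add_sum_Ico _ hle]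
      have ih' := ih (by omega)
      set S := ∑ i ∈ Finset.range k, (contDen b (i + 1) : ℝ) / contDen b i with hS
      have hS0 : 0 ≤ S := by positivity
      have hterm : ∀ l ∈ Finset.Ico (contDen b k) (contDen b (k + 1)),
          |sawSum β γ (l + 1)| / ((l : ℝ) + 1) ^ 2 ≤
            6 * S * (1 / ((l : ℝ) + 1) ^ 2) + 6 / contDen b k * (1 / ((l : ℝ) + 1)) := by
        intro l hl
        have hl2 := (Finset.mem_Ico.1 hl).2
        have h := abs_sawSum_le rfl (contDen_pos hb) k (fun i hi => hβ i (by omega)) (l + 1)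
          (by omega) γ
        have hl0 : (0 : ℝ) < (l : ℝ) + 1 := by positivity
        rw [div_le_iff₀ (by positivity)]
        refine h.trans (le_of_eq ?_)
        rw [← hS]
        have := hp k
        push_cast
        field_simp
      have hsum := Finset.sum_le_sum hterm
      rw [Finset.sum_add_distrib, ← Finset.mul_sum, ← Finset.mul_sum] at hsum
      have h1 := sum_Ico_inv_sq_le (contDen_pos hb k) hle
      have h2 := (sum_Ico_inv_le (contDen_pos hb k) hle).trans
        (log_contDen_ratio_le hb (t := c * (k + 1 : ℕ)) (by positivity)
          (hexp (k + 1) (by omega) hk))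
      have h1' : ∑ l ∈ Finset.Ico (contDen b k) (contDen b (k + 1)), 1 / ((l : ℝ) + 1) ^ 2 ≤
          1 / (contDen b k : ℝ) := by
        have : 0 < 1 / (contDen b (k + 1) : ℝ) := one_div_pos.2 (hp _)
        linarith
      have h3 := mul_le_mul_of_nonneg_left h1' (show 0 ≤ 6 * S by positivity)
      have h4 := mul_le_mul_of_nonneg_left h2 (show 0 ≤ 6 / (contDen b k : ℝ) by positivity)
      have e : 6 * S * (1 / (contDen b k : ℝ)) + 6 / contDen b k * (1 + c * (k + 1 : ℕ)) =
          6 * (S / contDen b k + (1 + c) * (1 / (contDen b k : ℝ)) +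
            c * ((k : ℝ) / contDen b k)) := by
        push_cast; ring
      linarith
  refine (key n le_rfl).trans ?_
  rw [← Finset.mul_sum, Finset.sum_add_distrib, Finset.sum_add_distrib, ← Finset.mul_sum,
    ← Finset.mul_sum]
  have h1 := sum_ratio_div_contDen_le hb n
  have h2 := mul_le_mul_of_nonneg_left (sum_inv_contDen_le hb n) (show 0 ≤ 1 + c by positivity)
  have h3 := mul_le_mul_of_nonneg_left (sum_id_div_contDen_le hb n) hc.le
  linarith

/-- Uniform bound for harmonically weighted sawtooth sums along the rotation by `± q_{n-1} / q_n`,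
under an exponential bound on the reversed partial quotients. -/
theorem exists_weighted_sawtooth_bound {c : ℝ} (hc : 0 < c) :
    ∃ C > 0, ∀ a : ℕ → ℕ, (∀ i, 1 ≤ a i) → ∀ n : ℕ,
      (∀ m, 1 ≤ m → m ≤ n → (a (n + 1 - m) : ℝ) ≤ Real.exp (c * m)) →
      ∀ σ : ℤ, (σ = 1 ∨ σ = -1) → ∀ γ : ℝ,
      |∑ l ∈ Finset.range (contDen a n),
        (Int.fract (γ + l * (σ * (contDen a (n - 1) / contDen a n : ℝ))) - 1 / 2) /
          ((l : ℝ) + 1 / 2)| ≤ C := by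
  refine ⟨1 + 2 * (1 / 2 + 6 * (18 + 4 * (1 + c) + 10 * c)), by positivity, ?_⟩
  intro a ha n hexp σ hσ γ
  refine (abs_weighted_sawtooth_le _ _ _).trans ?_
  rw [← contDen_reverse a n]
  have hb : ∀ i, 1 ≤ (fun i => a (n + 1 - i)) i := fun i => ha _
  have := sum_sawSum_div_sq_le hb hc hexp
    (β := σ * (contDen a (n - 1) / contDen (fun i => a (n + 1 - i)) n : ℝ)) (fun m hm γ => by
      refine abs_sum_sawtooth_le (contDen_pos hb m)
        (P := σ * contNum (fun i => a (n + 1 - i)) m) ?_ ?_ γ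
      · have := isCoprime_contNum_contDen (fun i => a (n + 1 - i)) m
        rcases hσ with rfl | rfl
        · simpa only [Int.cast_one, one_mul] using this
        · simpa only [neg_mul, one_mul] using this.neg_left
      · have := abs_reverse_sub_le ha n m hm
        rw [contDen_reverse a n]
        push_cast
        rw [mul_div_assoc, ← mul_sub, abs_mul]
        rcases hσ with rfl | rfl <;> simpa using this) γ
  linarith

end Discrepancy

section SymLog

theorem abs_log_add_sub_le {z ε : ℝ} (hz : 0 < z) (hε : |ε / z| ≤ 1 / 2) :
    |Real.log (z + ε) - Real.log z - ε / z| ≤ 2 * (ε / z) ^ 2 := by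
  have h := Real.abs_log_sub_add_sum_range_le (x := -(ε / z)) (by rw [abs_neg]; linarith) 1
  have h' := abs_le.1 hε
  have e : z + ε = z * (1 + ε / z) := by field_simp
  rw [e, Real.log_mul hz.ne' (by linarith), add_sub_cancel_left]
  simp only [Finset.sum_range_one, abs_neg, sub_neg_eq_add] at h
  rw [show Real.log (1 + ε / z) - ε / z =
    (-(ε / z)) ^ (0 + 1) / ((0 : ℕ) + 1) + Real.log (1 + ε / z) by simp; ring]
  refine h.trans ?_
  rw [div_le_iff₀ (by linarith), sq_abs]
  nlinarith [sq_nonneg (ε / z)]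

theorem abs_log_grid_sub_le {q : ℕ} (hq : 0 < q) (r : ℕ) {ε : ℝ} (hε : |ε * q| ≤ 1 / 4) :
    |Real.log (((r : ℝ) + 1 / 2) / q + ε) - Real.log (((r : ℝ) + 1 / 2) / q) -
      ε * q * (1 / ((r : ℝ) + 1 / 2))| ≤ 2 * (1 / ((r : ℝ) + 1 / 2) ^ 2) := by
  have hq' : (0 : ℝ) < q := by exact_mod_cast hq
  have hr : (0 : ℝ) ≤ r := by positivity
  have e : ε / (((r : ℝ) + 1 / 2) / q) = ε * q * (1 / ((r : ℝ) + 1 / 2)) := by field_simp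
  have hu : 1 / ((r : ℝ) + 1 / 2) ≤ 2 := by
    rw [div_le_iff₀ (by positivity)]; linarith
  have hu0 : 0 < 1 / ((r : ℝ) + 1 / 2) := by positivity
  have h := abs_log_add_sub_le (z := ((r : ℝ) + 1 / 2) / q) (ε := ε) (by positivity) (by
    rw [e, abs_mul, abs_of_pos hu0]
    calc |ε * q| * (1 / ((r : ℝ) + 1 / 2)) ≤ 1 / 4 * 2 := by gcongr
      _ = 1 / 2 := by norm_num)
  rw [e] at h
  refine h.trans ?_
  have h1 : (ε * q) ^ 2 ≤ 1 := by rw [← sq_abs]; nlinarith [abs_nonneg (ε * q)]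
  rw [mul_pow, one_div_pow]
  have h2 : 0 < 1 / ((r : ℝ) + 1 / 2) ^ 2 := by positivity
  nlinarith

theorem abs_symLog_grid_sub_le {q r r' : ℕ} (h : r + r' + 1 = q) {ε : ℝ} (hε : |ε * q| ≤ 1 / 4)
    (k : ℤ) :
    |symLog (k + ((r : ℝ) + 1 / 2) / q + ε) -
      (-Real.log (((r : ℝ) + 1 / 2) / q) - Real.log (((r' : ℝ) + 1 / 2) / q) +
        ε * q * (1 / ((r' : ℝ) + 1 / 2) - 1 / ((r : ℝ) + 1 / 2)))| ≤
      2 * (1 / ((r : ℝ) + 1 / 2) ^ 2) + 2 * (1 / ((r' : ℝ) + 1 / 2) ^ 2) := by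
  have hq : 0 < q := by omega
  have hq' : (0 : ℝ) < q := by exact_mod_cast hq
  have hqr : (r : ℝ) + r' + 1 = q := by exact_mod_cast h
  have hr : (0 : ℝ) ≤ r := by positivity
  have hr' : (0 : ℝ) ≤ r' := by positivity
  have h1 := abs_log_grid_sub_le hq r hε
  have h2 := abs_log_grid_sub_le hq r' (ε := -ε) (by rwa [neg_mul, abs_neg])
  have hε' := abs_le.1 hε
  have hz : ((r : ℝ) + 1 / 2) / q + ε = ((r : ℝ) + 1 / 2 + ε * q) / q := by field_simp
  have hz' : 1 - (((r : ℝ) + 1 / 2) / q + ε) = ((r' : ℝ) + 1 / 2) / q + -ε := by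
    rw [← hqr]
    have : (r : ℝ) + r' + 1 ≠ 0 := by positivity
    field_simp; ring
  have hf : Int.fract ((k : ℝ) + ((r : ℝ) + 1 / 2) / q + ε) = ((r : ℝ) + 1 / 2) / q + ε := by
    rw [Int.fract_eq_iff]
    refine ⟨?_, ?_, k, by ring⟩
    · rw [hz]; apply div_nonneg <;> linarith [hε'.1]
    · rw [hz, div_lt_one hq']; linarith [hε'.2]
  unfold symLog
  rw [hf, hz']
  rw [abs_le] at h1 h2 ⊢
  constructor <;> linarith [h1.1, h1.2, h2.1, h2.2]

theorem sum_inv_half_sq_le (N : ℕ) :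
    ∑ r ∈ Finset.range N, 1 / ((r : ℝ) + 1 / 2) ^ 2 ≤ 6 := by
  have : ∀ N : ℕ, ∑ r ∈ Finset.range (N + 1), 1 / ((r : ℝ) + 1 / 2) ^ 2 ≤
      6 - 1 / ((N : ℝ) + 1 / 2) := by
    intro N
    induction N with
    | zero => norm_num
    | succ N ih =>
      rw [Finset.sum_range_succ]
      have : 1 / (((N + 1 : ℕ) : ℝ) + 1 / 2) ^ 2 ≤ 1 / ((N : ℝ) + 1 / 2) -
          1 / (((N + 1 : ℕ) : ℝ) + 1 / 2) := by
        push_cast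
        rw [div_sub_div _ _ (by positivity) (by positivity),
          div_le_div_iff₀ (by positivity) (by positivity)]
        nlinarith [show (0 : ℝ) ≤ N by positivity]
      linarith
  cases N with
  | zero => norm_num
  | succ N =>
    have h := this N
    have : 0 < 1 / ((N : ℝ) + 1 / 2) := by positivity
    linarith

/-- Birkhoff sums of `symLog` over a full period, started near the midpoint of a grid interval,
stay close to the corresponding sum over the regular grid. -/
theorem abs_birkhoffRot_sub_grid_le {q : ℕ} (hq : 0 < q) {p u : ℤ} (hp : IsCoprime p (q : ℤ))
    (hu : (q : ℤ) ∣ u * p - 1) {C : ℝ}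
    (hC : ∀ σ : ℤ, (σ = 1 ∨ σ = -1) → ∀ γ : ℝ,
      |∑ l ∈ Finset.range q, (Int.fract (γ + l * (σ * (u / q : ℝ))) - 1 / 2) /
          ((l : ℝ) + 1 / 2)| ≤ C)
    {α y : ℝ} (hα : |(α - p / q) * q ^ 2| ≤ 1 / 100) {j : ℤ}
    (hy : |(y - (j + 1 / 2) / q) * q| ≤ 1 / 100) :
    |birkhoffRot α symLog q y - ∑ r ∈ Finset.range q,
      (-Real.log (((r : ℝ) + 1 / 2) / q) - Real.log ((((q - 1 - r : ℕ) : ℝ) + 1 / 2) / q))| ≤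
      24 + C := by
  have hq' : (0 : ℝ) < q := by exact_mod_cast hq
  obtain ⟨m, hm⟩ := hu
  set θ := y - (j + 1 / 2) / q with hθ
  set δ := α - p / q with hδ
  set F : ℕ → ℝ := fun r => Int.fract (((r : ℝ) - j) * (u / q)) with hF
  set w : ℕ → ℝ := fun r => 1 / (((q - 1 - r : ℕ) : ℝ) + 1 / 2) - 1 / ((r : ℝ) + 1 / 2) with hw
  set base : ℕ → ℝ := fun r =>
    -Real.log (((r : ℝ) + 1 / 2) / q) - Real.log ((((q - 1 - r : ℕ) : ℝ) + 1 / 2) / q) with hbase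
  set G : ℕ → ℝ := fun r => base r + (θ * q + δ * q ^ 2 * F r) * w r with hG
  set E : ℕ → ℝ := fun r =>
    2 * (1 / ((r : ℝ) + 1 / 2) ^ 2) + 2 * (1 / (((q - 1 - r : ℕ) : ℝ) + 1 / 2) ^ 2) with hE
  have key : ∀ i ∈ Finset.range q, |symLog (y + i * α) - G ((j + i * p) % (q : ℤ)).toNat| ≤
      E ((j + i * p) % (q : ℤ)).toNat := by
    intro i hi
    obtain ⟨k, hk, hr, hkz⟩ := exists_eq_mul_add_emod hq (j + i * p)
    set r := ((j + i * p) % (q : ℤ)).toNat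
    have hi' : (i : ℝ) < q := by exact_mod_cast Finset.mem_range.1 hi
    push_cast at hk
    have hr' : (r : ℝ) = j + i * p - k * q := by linarith
    have hm' : (u : ℝ) * p - 1 = q * m := by exact_mod_cast hm
    have hFr : F r = i / q := by
      simp only [hF]
      rw [Int.fract_eq_iff]
      refine ⟨by positivity, by rw [div_lt_one hq']; exact hi', i * m - k * u, ?_⟩
      push_cast
      rw [hr']
      field_simp
      linear_combination (i : ℝ) * hm'
    have hε : (θ + i * δ) * q = θ * q + δ * q ^ 2 * F r := by
      rw [hFr]; field_simp
    have hF0 : 0 ≤ F r := Int.fract_nonneg _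
    have hF1 : F r ≤ 1 := (Int.fract_lt_one _).le
    have hεb : |(θ + i * δ) * q| ≤ 1 / 4 := by
      rw [hε]
      refine (abs_add_le _ _).trans ?_
      rw [abs_mul _ (F r), abs_of_nonneg hF0]
      nlinarith [abs_nonneg (δ * (q : ℝ) ^ 2)]
    have h := abs_symLog_grid_sub_le (r := r) (r' := q - 1 - r) (q := q) (by omega) hεb k
    have e : (k : ℝ) + ((r : ℝ) + 1 / 2) / q + (θ + i * δ) = y + i * α := by
      rw [hr', hθ, hδ]; field_simp; ring
    rw [e, hε] at h
    exact h
  have hsum := (Finset.abs_sum_le_sum_abs _ _).trans (Finset.sum_le_sum key)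
  rw [Finset.sum_sub_distrib, sum_affine_emod hq hp j G, sum_affine_emod hq hp j E] at hsum
  have hEsum : ∑ r ∈ Finset.range q, E r ≤ 24 := by
    simp only [hE]
    rw [Finset.sum_add_distrib, ← Finset.mul_sum, ← Finset.mul_sum,
      Finset.sum_range_reflect (fun r => 1 / ((r : ℝ) + 1 / 2) ^ 2)]
    linarith [sum_inv_half_sq_le q]
  have hwsum : ∑ r ∈ Finset.range q, w r = 0 := by
    simp only [hw]
    rw [Finset.sum_sub_distrib, Finset.sum_range_reflect (fun r => 1 / ((r : ℝ) + 1 / 2)), sub_self]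
  have hGsum : ∑ r ∈ Finset.range q, G r - ∑ r ∈ Finset.range q, base r =
      δ * q ^ 2 * ∑ r ∈ Finset.range q, (F r - 1 / 2) * w r := by
    have : ∀ r, G r = base r + (θ * q + δ * q ^ 2 / 2) * w r +
        δ * q ^ 2 * ((F r - 1 / 2) * w r) := fun r => by simp only [hG]; ring
    simp only [this]
    rw [Finset.sum_add_distrib, Finset.sum_add_distrib, ← Finset.mul_sum, ← Finset.mul_sum, hwsum]
    ring
  have hFw : |∑ r ∈ Finset.range q, (F r - 1 / 2) * w r| ≤ 2 * C := by
    have e1 : ∑ r ∈ Finset.range q, (F r - 1 / 2) * w r =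
        ∑ r ∈ Finset.range q, (F (q - 1 - r) - 1 / 2) / ((r : ℝ) + 1 / 2) -
          ∑ r ∈ Finset.range q, (F r - 1 / 2) / ((r : ℝ) + 1 / 2) := by
      rw [← Finset.sum_range_reflect
        (fun r => (F (q - 1 - r) - 1 / 2) / ((r : ℝ) + 1 / 2)), ← Finset.sum_sub_distrib]
      refine Finset.sum_congr rfl fun r hr => ?_
      have hr' := Finset.mem_range.1 hr
      rw [show q - 1 - (q - 1 - r) = r by omega]
      simp only [hw]; ring
    have h1 := hC 1 (Or.inl rfl) (-j * (u / q))
    have h2 := hC (-1) (Or.inr rfl) ((q - 1 - j) * (u / q))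
    have e2 : ∑ r ∈ Finset.range q, (F r - 1 / 2) / ((r : ℝ) + 1 / 2) =
        ∑ l ∈ Finset.range q, (Int.fract (-j * (u / q) + l * ((1 : ℤ) * (u / q : ℝ))) - 1 / 2) /
          ((l : ℝ) + 1 / 2) := by
      refine Finset.sum_congr rfl fun r _ => ?_
      simp only [hF]; push_cast; ring_nf
    have e3 : ∑ r ∈ Finset.range q, (F (q - 1 - r) - 1 / 2) / ((r : ℝ) + 1 / 2) =
        ∑ l ∈ Finset.range q,
          (Int.fract ((q - 1 - j) * (u / q) + l * ((-1 : ℤ) * (u / q : ℝ))) - 1 / 2) /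
          ((l : ℝ) + 1 / 2) := by
      refine Finset.sum_congr rfl fun r hr => ?_
      have hr' := Finset.mem_range.1 hr
      have hc : ((q - 1 - r : ℕ) : ℝ) = q - 1 - r := by
        rw [Nat.cast_sub (by omega), Nat.cast_sub (by omega)]; simp
      simp only [hF, hc]; push_cast
      congr 3; ring
    rw [e1, e2, e3]
    refine (abs_sub _ _).trans ?_
    linarith
  have hfin : |∑ r ∈ Finset.range q, G r - ∑ r ∈ Finset.range q, base r| ≤ C := by
    rw [hGsum, abs_mul]
    have h0 := abs_nonneg (∑ r ∈ Finset.range q, (F r - 1 / 2) * w r)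
    nlinarith
  unfold birkhoffRot
  have := abs_add_le (∑ i ∈ Finset.range q, symLog (y + i * α) - ∑ r ∈ Finset.range q, G r)
    (∑ r ∈ Finset.range q, G r - ∑ r ∈ Finset.range q, base r)
  rw [sub_add_sub_cancel] at this
  linarith

end SymLog

section Partition

theorem fract_neg_mul_eq_grid {q : ℕ} (hq : 0 < q) {p : ℤ} {α : ℝ} (i : ℕ) :
    ∃ a t : ℤ, a = -(i : ℤ) * p - t * q ∧
      Int.fract (-(i : ℝ) * α) * q = a - i * ((α - p / q) * q) := by
  have hq' : (0 : ℝ) < q := by exact_mod_cast hq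
  refine ⟨_, ⌊-(i : ℝ) * α⌋, rfl, ?_⟩
  rw [Int.fract]
  push_cast
  field_simp
  ring

/-- Midpoints of the partition intervals are close to midpoints of the regular grid. -/
theorem IsPartitionInterval.exists_midpoint_near {α : ℝ} {q : ℕ} {v w : ℝ}
    (h : IsPartitionInterval α q v w) (hq : 0 < q) {p : ℤ} (hp : IsCoprime p (q : ℤ))
    (hα : |(α - p / q) * q ^ 2| ≤ 1 / 100) :
    ∃ j : ℤ, |((v + w) / 2 - (j + 1 / 2) / q) * q| ≤ 1 / 100 := by
  have hq' : (0 : ℝ) < q := by exact_mod_cast hq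
  obtain ⟨⟨i, hi, rfl⟩, hw, hvw, hno⟩ := h
  simp only [Set.mem_Iio] at hi
  have hsmall : ∀ i : ℕ, i < q → |(i : ℝ) * ((α - p / q) * q)| ≤ 1 / 100 := by
    intro i hi
    have hi' : (i : ℝ) ≤ q := by exact_mod_cast hi.le
    refine le_trans ?_ hα
    rw [show (α - p / q) * (q : ℝ) ^ 2 = q * ((α - p / q) * q) by ring, abs_mul, abs_mul (q : ℝ),
      Nat.abs_cast, Nat.abs_cast]
    gcongr
  obtain ⟨a, t, hat, ha⟩ := fract_neg_mul_eq_grid hq (p := p) (α := α) i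
  have hsi := abs_le.1 (hsmall i hi)
  simp only at hvw hno ⊢
  have hv0 := Int.fract_nonneg (-(i : ℝ) * α)
  set v := Int.fract (-(i : ℝ) * α) with hv
  have hw1 : w ≤ 1 := by
    rcases hw with ⟨i', _, rfl⟩ | rfl
    · exact (Int.fract_lt_one _).le
    · exact le_rfl
  have hvw' : v * q < w * q := by gcongr
  obtain ⟨b, hb, hba⟩ : ∃ b : ℤ, |w * q - b| ≤ 1 / 100 ∧ b ≠ a := by
    rcases hw with ⟨i', hi', rfl⟩ | rfl
    · simp only [Set.mem_Iio] at hi'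
      obtain ⟨b, t', hbt, hb⟩ := fract_neg_mul_eq_grid hq (p := p) (α := α) i'
      refine ⟨b, ?_, ?_⟩
      · simp only [hb, sub_sub_cancel_left, abs_neg]; exact hsmall i' hi'
      · rintro rfl
        have h1 : (q : ℤ) ∣ ((i' : ℤ) - i) * p := ⟨t - t', by linear_combination hbt - hat⟩
        have h2 := Int.eq_zero_of_abs_lt_dvd (hp.symm.dvd_of_dvd_mul_right h1)
          (by rw [abs_lt]; constructor <;> omega)
        have h3 : i' = i := by omega
        rw [h3] at hvw
        exact lt_irrefl _ hvw
    · refine ⟨q, by norm_num, ?_⟩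
      rintro rfl
      have h1 : (q : ℤ) ∣ (i : ℤ) * p := ⟨-t - 1, by linear_combination hat⟩
      have h2 := Int.eq_zero_of_abs_lt_dvd (hp.symm.dvd_of_dvd_mul_right h1)
        (by rw [abs_lt]; constructor <;> omega)
      have h3 : i = 0 := by omega
      subst h3
      have h4 : v = 0 := by rw [hv]; simp
      rw [h4] at ha
      push_cast at ha
      linarith
  rw [abs_le] at hb
  have hab : a < b := by
    refine lt_of_le_of_ne ?_ hba.symm
    by_contra! hlt
    have : (b : ℝ) + 1 ≤ a := by exact_mod_cast hlt
    linarith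
  have hba1 : b = a + 1 := by
    by_contra hne
    have hb2 : (a : ℝ) + 2 ≤ b := by exact_mod_cast (by omega : a + 2 ≤ b)
    obtain ⟨i'', hi'', hr⟩ := surjOn_affine_emod hq hp.neg_left 0
      (show ((a + 1) % (q : ℤ)).toNat ∈ (Finset.range q : Set ℕ) by
        have := Int.emod_nonneg (a + 1) (show (q : ℤ) ≠ 0 by omega)
        have := Int.emod_lt_of_pos (a + 1) (show (0 : ℤ) < q by omega)
        simp only [Finset.coe_range, Set.mem_Iio]; omega)
    simp only [Finset.coe_range, Set.mem_Iio] at hi''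
    obtain ⟨k1, -, -, hk1⟩ := exists_eq_mul_add_emod hq (0 + i'' * -p)
    obtain ⟨k2, -, -, hk2⟩ := exists_eq_mul_add_emod hq (a + 1)
    simp only at hr
    have hs := abs_le.1 (hsmall i'' hi'')
    have hz : ((i'' : ℤ) * -p : ℤ) = a + 1 + (k1 - k2) * q := by
      rw [hr] at hk1; linear_combination hk1 - hk2
    have hz' : ((i'' : ℝ) * -p) = a + 1 + (k1 - k2) * q := by exact_mod_cast hz
    set x : ℝ := ((a : ℝ) + 1 - i'' * ((α - p / q) * q)) / q with hx
    have hxq : x * q = (a : ℝ) + 1 - i'' * ((α - p / q) * q) := by rw [hx]; field_simp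
    have hvx : v < x := lt_of_mul_lt_mul_right (by linarith) hq'.le
    have hxw : x < w := lt_of_mul_lt_mul_right (by linarith) hq'.le
    refine hno x ⟨i'', hi'', ?_⟩ ⟨hvx, hxw⟩
    simp only
    rw [Int.fract_eq_iff]
    refine ⟨by linarith, by linarith, k1 - k2, ?_⟩
    rw [hx]; push_cast; field_simp
    linear_combination hz'
  refine ⟨a, ?_⟩
  have hb' : (b : ℝ) = a + 1 := by exact_mod_cast hba1
  have e : ((v + w) / 2 - ((a : ℝ) + 1 / 2) / q) * q = (v * q - a) / 2 + (w * q - b) / 2 := by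
    rw [hb']; field_simp; ring
  rw [e, ha, abs_le]
  constructor <;> linarith

end Partition

section GaussMap

variable {α : ℝ}

theorem gaussIter_succ (α : ℝ) (n : ℕ) :
    gaussIter α (n + 1) = Int.fract (gaussIter α n)⁻¹ :=
  Function.iterate_succ_apply' _ _ _

theorem irrational_gaussIter (h : Irrational α) (n : ℕ) : Irrational (gaussIter α n) := by
  induction n with
  | zero =>
    change Irrational (Int.fract α)
    exact h.sub_intCast _
  | succ n ih => rw [gaussIter_succ]; exact ih.inv.sub_intCast _

theorem gaussIter_pos (h : Irrational α) (n : ℕ) : 0 < gaussIter α n := by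
  refine lt_of_le_of_ne ?_ (irrational_gaussIter h n).ne_zero.symm
  cases n with
  | zero => exact Int.fract_nonneg _
  | succ n => rw [gaussIter_succ]; exact Int.fract_nonneg _

theorem gaussIter_lt_one (α : ℝ) (n : ℕ) : gaussIter α n < 1 := by
  cases n with
  | zero => exact Int.fract_lt_one _
  | succ n => rw [gaussIter_succ]; exact Int.fract_lt_one _

theorem one_le_cfA (h : Irrational α) (n : ℕ) : 1 ≤ cfA α n := by
  unfold cfA
  rw [Nat.one_le_floor_iff]
  exact (one_le_inv₀ (gaussIter_pos h _)).2 (gaussIter_lt_one α _).le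

theorem inv_gaussIter (h : Irrational α) (n : ℕ) :
    (gaussIter α n)⁻¹ = cfA α (n + 1) + gaussIter α (n + 1) := by
  rw [gaussIter_succ, cfA, Nat.add_sub_cancel,
    natCast_floor_eq_intCast_floor (inv_pos.2 (gaussIter_pos h n)).le]
  exact (Int.floor_add_fract _).symm

theorem cfQ_eq_contDen (α : ℝ) (n : ℕ) : cfQ α n = contDen (cfA α) n := by
  induction n using Nat.twoStepInduction with
  | zero => rfl
  | one => rfl
  | more n ih1 ih2 => rw [contDen_add_two, ← ih1, ← ih2]; rfl

theorem contDen_mul_sub_succ (h : Irrational α) (hα : α ∈ Set.Ioo (0 : ℝ) 1) (n : ℕ) :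
    contDen (cfA α) (n + 1) * α - contNum (cfA α) (n + 1) =
      -gaussIter α (n + 1) * (contDen (cfA α) n * α - contNum (cfA α) n) := by
  have hx := inv_gaussIter h n
  have hp := gaussIter_pos h n
  have hx' : 1 = (cfA α (n + 1) + gaussIter α (n + 1)) * gaussIter α n := by
    rw [← hx]; field_simp
  induction n with
  | zero =>
    have h0 : gaussIter α 0 = α := Int.fract_eq_self.2 ⟨hα.1.le, hα.2⟩
    rw [h0] at hx'
    simp only [contDen, contNum]
    push_cast
    linear_combination -hx'
  | succ n ih =>
    have hp' := gaussIter_pos h n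
    have ih' := ih (inv_gaussIter h n) hp' (by rw [← inv_gaussIter h n]; field_simp)
    rw [contDen_add_two, contNum_add_two]
    push_cast
    linear_combination (contDen (cfA α) n * α - contNum (cfA α) n) * hx' +
      (cfA α (n + 2) + gaussIter α (n + 2)) * ih'

theorem abs_sub_convergent_le (h : Irrational α) (hα : α ∈ Set.Ioo (0 : ℝ) 1) (n : ℕ) :
    |(α - contNum (cfA α) n / contDen (cfA α) n) * (contDen (cfA α) n : ℝ) ^ 2| *
      cfA α (n + 1) ≤ 1 := by
  have ha := one_le_cfA h
  have hq : (0 : ℝ) < contDen (cfA α) n := by exact_mod_cast contDen_pos ha n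
  have hx := gaussIter_pos h (n + 1)
  have hstep := contDen_mul_sub_succ h hα n
  have hdet : (contNum (cfA α) (n + 1) : ℝ) * contDen (cfA α) n -
      contNum (cfA α) n * contDen (cfA α) (n + 1) = (-1) ^ n := by
    exact_mod_cast contNum_mul_contDen_sub (cfA α) n
  have hle : (cfA α (n + 1) : ℝ) * contDen (cfA α) n ≤ contDen (cfA α) (n + 1) := by
    exact_mod_cast mul_contDen_le_succ (cfA α) n
  set e := (contDen (cfA α) n : ℝ) * α - contNum (cfA α) n
  have h1 : e * (contDen (cfA α) (n + 1) + contDen (cfA α) n * gaussIter α (n + 1)) =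
      (-1) ^ n := by
    simp only [e] at hstep ⊢
    linear_combination hdet + contDen (cfA α) n * hstep
  have h2 : |e| * (contDen (cfA α) (n + 1) + contDen (cfA α) n * gaussIter α (n + 1)) = 1 := by
    have := congrArg abs h1
    rwa [abs_mul, abs_pow, abs_neg, abs_one, one_pow, abs_of_pos (a := (_ + _ : ℝ))
      (by positivity)] at this
  have h3 : (α - contNum (cfA α) n / contDen (cfA α) n) * (contDen (cfA α) n : ℝ) ^ 2 =
      e * contDen (cfA α) n := by
    simp only [e]; field_simp
  rw [h3, abs_mul, Nat.abs_cast]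
  nlinarith [abs_nonneg e, mul_nonneg (abs_nonneg e) (mul_pos hq hx).le]

/-- `(-1)^(n-1) q_{n-1}` is an inverse of `p_n` modulo `q_n`. -/
theorem exists_sign_inverse (b : ℕ → ℕ) (n : ℕ) :
    ∃ s : ℤ, (s = 1 ∨ s = -1) ∧
      (contDen b n : ℤ) ∣ s * contDen b (n - 1) * contNum b n - 1 := by
  cases n with
  | zero => exact ⟨1, Or.inl rfl, by simp [contDen]⟩
  | succ n =>
    refine ⟨(-1) ^ n, neg_one_pow_eq_or ℤ n, (-1) ^ n * contNum b n, ?_⟩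
    have h := contNum_mul_contDen_sub b n
    have h2 : ((-1 : ℤ) ^ n) * (-1) ^ n = 1 := by rw [← mul_pow]; simp
    rw [Nat.add_sub_cancel]
    linear_combination (-1) ^ n * h + h2

end GaussMap

/-- For `α ∈ 𝒞_{K,L}` (`L > K`) with associated sequence `(n_k)` and
`h(x) = -log x - log(1-x)`: there exists `C''' > 0` such that for every `k` and every
partition interval `I_s = (v_s, w_s)` of `𝕋` by `{-iα}_{i<q_{n_k}}`, with `y_s` the
midpoint of `I_s`: `|S_{q_{n_k}}(h)(y_s) - c_k^h| < C'''`, where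
`c_k^h = S_{q_{n_k}}(h)(1/(2q_{n_k}))`. -/
theorem statement16 (K L : ℕ) (hKL : K < L)
    (α : ℝ) (hirr : Irrational α) (hα : α ∈ Set.Ioo (0 : ℝ) 1)
    (nk : ℕ → ℕ) (hnk : StrictMono nk) (c : ℝ) (hc : 0 < c)
    (hdio1 : ∀ k n : ℕ, 1 ≤ n → n ≤ nk k →
      (cfA α (nk k + 1 - n) : ℝ) ≤ Real.exp (c * n))
    (hdio2 : ∀ k : ℕ, 100 * (K ^ 2 + L ^ 2) < cfA α (nk k + 1) ∧
      cfA α (nk k + 1) < 200 * (K ^ 2 + L ^ 2)) :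
    ∃ C3 > (0 : ℝ), ∀ k : ℕ, ∀ v w : ℝ,
      IsPartitionInterval α (cfQ α (nk k)) v w →
      |birkhoffRot α symLog (cfQ α (nk k)) ((v + w) / 2)
          - birkhoffRot α symLog (cfQ α (nk k)) (1 / (2 * (cfQ α (nk k) : ℝ)))|
        < C3 := by
  obtain ⟨C, hC0, hC⟩ := exists_weighted_sawtooth_bound hc
  refine ⟨2 * (24 + C) + 1, by positivity, fun k v w hvw => ?_⟩
  have ha := one_le_cfA hirr
  obtain ⟨s, hs, hinv⟩ := exists_sign_inverse (cfA α) (nk k)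
  have hcop := isCoprime_contNum_contDen (cfA α) (nk k)
  have hq := contDen_pos ha (nk k)
  rw [cfQ_eq_contDen] at hvw ⊢
  have hC' := hC (cfA α) ha (nk k) (hdio1 k)
  set q := contDen (cfA α) (nk k) with hqdef
  have hq' : (0 : ℝ) < q := by exact_mod_cast hq
  have hbig : (100 : ℝ) ≤ cfA α (nk k + 1) := by
    have h1 := (hdio2 k).1
    have h2 : 1 ≤ K ^ 2 + L ^ 2 := by nlinarith
    exact_mod_cast (by omega : 100 ≤ cfA α (nk k + 1))
  have happrox := abs_sub_convergent_le hirr hα (nk k)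
  rw [← hqdef] at happrox
  have hα' : |(α - ((contNum (cfA α) (nk k) : ℤ) : ℝ) / q) * (q : ℝ) ^ 2| ≤ 1 / 100 := by
    rw [Int.cast_natCast]
    nlinarith [abs_nonneg ((α - (contNum (cfA α) (nk k) : ℝ) / q) * (q : ℝ) ^ 2)]
  have hsaw : ∀ σ : ℤ, (σ = 1 ∨ σ = -1) → ∀ γ : ℝ,
      |∑ l ∈ Finset.range q, (Int.fract (γ + l * (σ *
        (((s * contDen (cfA α) (nk k - 1) : ℤ) : ℝ) / q))) - 1 / 2) / ((l : ℝ) + 1 / 2)| ≤ C := by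
    intro σ hσ γ
    have := hC' (σ * s) (by rcases hσ with rfl | rfl <;> rcases hs with rfl | rfl <;> simp) γ
    have e : (σ : ℝ) * (((s * contDen (cfA α) (nk k - 1) : ℤ) : ℝ) / q) =
        (σ * s : ℤ) * (contDen (cfA α) (nk k - 1) / q : ℝ) := by
      push_cast; ring
    rwa [e]
  obtain ⟨j, hj⟩ := hvw.exists_midpoint_near hq hcop hα'
  have h1 := abs_birkhoffRot_sub_grid_le hq hcop hinv hsaw hα' hj
  have h2 := abs_birkhoffRot_sub_grid_le hq hcop hinv hsaw hα' (j := 0) (y := 1 / (2 * (q : ℝ)))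
    (by
      rw [show (1 / (2 * (q : ℝ)) - (((0 : ℤ) : ℝ) + 1 / 2) / q) * q = 0 by
        push_cast; field_simp; ring]
      norm_num)
  rw [abs_le] at h1 h2
  rw [abs_lt]
  constructor <;> linarith [h1.1, h1.2, h2.1, h2.2]
end
end

section
/- Let K, L ∈ ℕ with L > K, let α ∈ 𝒞_{K,L} with associated sequence (n_k), and let h(x) = -log x - log(1-x). There exists a constant C'''' > 0 such that for every k, every interval I_s = (v_s, w_s) of the partition of 𝕋 by the points {−iα}_{i=0}^{q_{n_k}−1}, and every x ∈ I_s: |S_{q_{n_k}}(h)(x) − S_{q_{n_k}}(h)(y_s) + log(2(x−v_s)/|I_s|) + log(2(w_s−x)/|I_s|)| ≤ C'''', where y_s is the midpoint of I_s and |I_s| = w_s − v_s. -/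
open MeasureTheory Filter Topology

noncomputable section

/-- `P` enumerates, in increasing order, a `1`-periodic family of points of the line with `q` points
per period, each of them close to the corresponding point of the grid `ℤ / q`. -/
structure IsNearGrid (q : ℕ) (P : ℤ → ℝ) : Prop where
  pos : 0 < q
  near : ∀ m : ℤ, |q * P m - m| ≤ 1 / 100
  add_period : ∀ m : ℤ, P (m + q) = P m + 1

theorem IsNearGrid.strictMono {q : ℕ} {P : ℤ → ℝ} (h : IsNearGrid q P) : StrictMono P := by
  intro m m' hm
  have hq : (0 : ℝ) < q := by exact_mod_cast h.pos
  have h1 := abs_le.1 (h.near m)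
  have h2 := abs_le.1 (h.near m')
  have h3 : (m : ℝ) + 1 ≤ m' := by exact_mod_cast hm
  exact lt_of_mul_lt_mul_left (by linarith : (q : ℝ) * P m < q * P m') hq.le

theorem abs_log_sub_log_le {M N ε : ℝ} (hM : 0 < M) (hN : 0 < N) (h : |N - M| ≤ ε * M)
    (h' : |N - M| ≤ ε * N) : |Real.log N - Real.log M| ≤ ε := by
  have h1 := Real.log_le_sub_one_of_pos (div_pos hN hM)
  have h2 := Real.log_le_sub_one_of_pos (div_pos hM hN)
  rw [Real.log_div hN.ne' hM.ne'] at h1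
  rw [Real.log_div hM.ne' hN.ne'] at h2
  have h3 : N / M - 1 ≤ ε := by
    rw [sub_le_iff_le_add, div_le_iff₀ hM]; linarith [(abs_le.1 h).2]
  have h4 : M / N - 1 ≤ ε := by
    rw [sub_le_iff_le_add, div_le_iff₀ hN]; linarith [(abs_le.1 h').1]
  exact abs_le.2 ⟨by linarith, by linarith⟩

/-- Moving `d` from one factor of a nearly balanced product to the other changes its logarithm
only by a quantity quadratically small in the size of the factors. -/
theorem abs_log_symm_shift_le {a b d t : ℝ} (ht : 0 ≤ t) (ha : t + 1.48 ≤ a) (hb : t + 1.48 ≤ b)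
    (hab : |a - b| ≤ 0.04) (hd : |d| ≤ 0.51) :
    |Real.log (a + d) + Real.log (b - d) - Real.log a - Real.log b|
      ≤ 1 / (t + 1) - 1 / (t + 1 + 1) := by
  have hd' := abs_le.1 hd
  have ha0 : 0 < a := by linarith
  have hb0 : 0 < b := by linarith
  have ha1 : 0 < a + d := by linarith
  have hb1 : 0 < b - d := by linarith
  have hε : 1 / (t + 1) - 1 / (t + 1 + 1) = 1 / ((t + 1) * (t + 1 + 1)) := by
    field_simp; ring
  have hprod : (t + 1.48) * (t + 1.48) ≤ a * b := mul_le_mul ha hb (by linarith) ha0.le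
  have hdiff : |(a + d) * (b - d) - a * b| ≤ 0.3 := by
    have e : (a + d) * (b - d) - a * b = -(d * (a - b)) - d * d := by ring
    have h1 : |d * (a - b)| ≤ 0.51 * 0.04 := by
      rw [abs_mul]; exact mul_le_mul hd hab (abs_nonneg _) (by norm_num)
    have h2 : |d * d| ≤ 0.51 * 0.51 := by
      rw [abs_mul]; exact mul_le_mul hd hd (abs_nonneg _) (by norm_num)
    have h1' := abs_le.1 h1
    have h2' := abs_le.1 h2
    rw [e]
    exact abs_le.2 ⟨by linarith, by linarith⟩
  have hbig : ∀ X : ℝ, (t + 1.48) * (t + 1.48) - 0.3 ≤ X →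
      0.3 ≤ 1 / ((t + 1) * (t + 1 + 1)) * X := by
    intro X hX
    rw [one_div, inv_mul_eq_div, le_div_iff₀ (by positivity)]
    nlinarith
  have h := abs_log_sub_log_le (mul_pos ha0 hb0) (mul_pos ha1 hb1)
    (hdiff.trans (hbig _ (by linarith)))
    (hdiff.trans (hbig _ (by linarith [(abs_le.1 hdiff).1])))
  rw [Real.log_mul ha0.ne' hb0.ne', Real.log_mul ha1.ne' hb1.ne'] at h
  rw [hε]
  convert h using 2
  ring

theorem IsNearGrid.abs_log_sub_log_midpoint_le {q : ℕ} {P : ℤ → ℝ} (h : IsNearGrid q P) (s : ℤ)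
    (j : ℕ) {x : ℝ} (hx : x ∈ Set.Ioo (P s) (P (s + 1))) :
    |(Real.log (x - P (s - (j + 1 : ℕ))) + Real.log (P (s + 1 + (j + 1 : ℕ)) - x))
      - (Real.log ((P s + P (s + 1)) / 2 - P (s - (j + 1 : ℕ)))
        + Real.log (P (s + 1 + (j + 1 : ℕ)) - (P s + P (s + 1)) / 2))|
      ≤ 1 / ((j : ℝ) + 1) - 1 / (((j + 1 : ℕ) : ℝ) + 1) := by
  have hq : (0 : ℝ) < q := by exact_mod_cast h.pos
  set y := (P s + P (s + 1)) / 2 with hy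
  set A := P (s - (j + 1 : ℕ)) with hA
  set B := P (s + 1 + (j + 1 : ℕ)) with hB
  have h1 := abs_le.1 (h.near s)
  have h2 := abs_le.1 (h.near (s + 1))
  have h3 := abs_le.1 (h.near (s - (j + 1 : ℕ)))
  have h4 := abs_le.1 (h.near (s + 1 + (j + 1 : ℕ)))
  rw [← hA] at h3
  rw [← hB] at h4
  push_cast at h2 h3 h4
  have hx1 := mul_lt_mul_of_pos_left hx.1 hq
  have hx2 := mul_lt_mul_of_pos_left hx.2 hq
  have hqy : q * y = (q * P s + q * P (s + 1)) / 2 := by rw [hy]; ring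
  have hj : (0 : ℝ) ≤ j := Nat.cast_nonneg j
  have key := abs_log_symm_shift_le (a := q * (y - A)) (b := q * (B - y)) (d := q * (x - y)) hj
    (by rw [mul_sub]; linarith) (by rw [mul_sub]; linarith)
    (by rw [mul_sub, mul_sub]; exact abs_le.2 ⟨by linarith, by linarith⟩)
    (by rw [mul_sub]; exact abs_le.2 ⟨by linarith, by linarith⟩)
  have e1 : q * (y - A) + q * (x - y) = q * (x - A) := by ring
  have e2 : q * (B - y) - q * (x - y) = q * (B - x) := by ring
  have hne : ∀ u : ℝ, 0 < q * u → Real.log (q * u) = Real.log q + Real.log u := fun u hu =>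
    Real.log_mul hq.ne' (pos_of_mul_pos_right hu hq.le).ne'
  rw [e1, e2, hne _ (by rw [mul_sub]; linarith), hne _ (by rw [mul_sub]; linarith),
    hne _ (by rw [mul_sub]; linarith), hne _ (by rw [mul_sub]; linarith)] at key
  push_cast
  convert key using 2
  ring

/-- The sum of the logarithms of the left and right distances from `x` to all points of a near grid,
where `x` lies between the `s`-th point and the next one. -/
def gridLogSum (q : ℕ) (P : ℤ → ℝ) (s : ℤ) (x : ℝ) : ℝ :=
  ∑ j ∈ Finset.range q, (Real.log (x - P (s - j)) + Real.log (P (s + 1 + j) - x))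

theorem IsNearGrid.abs_gridLogSum_sub_le {q : ℕ} {P : ℤ → ℝ} (h : IsNearGrid q P) (s : ℤ)
    {x : ℝ} (hx : x ∈ Set.Ioo (P s) (P (s + 1))) :
    |-gridLogSum q P s x + gridLogSum q P s ((P s + P (s + 1)) / 2)
      + Real.log (2 * (x - P s) / (P (s + 1) - P s))
      + Real.log (2 * (P (s + 1) - x) / (P (s + 1) - P s))| ≤ 1 := by
  obtain ⟨r, rfl⟩ : ∃ r, q = r + 1 := ⟨q - 1, by have := h.pos; omega⟩
  have hvw : 0 < P (s + 1) - P s := by linarith [hx.1, hx.2]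
  have hxv : 0 < x - P s := sub_pos.2 hx.1
  have hxw : 0 < P (s + 1) - x := sub_pos.2 hx.2
  have ev : 2 * (x - P s) / (P (s + 1) - P s) = (x - P s) / ((P s + P (s + 1)) / 2 - P s) := by
    rw [div_eq_div_iff hvw.ne' (by linarith)]; ring
  have ew : 2 * (P (s + 1) - x) / (P (s + 1) - P s)
      = (P (s + 1) - x) / (P (s + 1) - (P s + P (s + 1)) / 2) := by
    rw [div_eq_div_iff hvw.ne' (by linarith)]; ring
  have hsum : |∑ j ∈ Finset.range r,
      ((Real.log (x - P (s - (j + 1 : ℕ))) + Real.log (P (s + 1 + (j + 1 : ℕ)) - x))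
      - (Real.log ((P s + P (s + 1)) / 2 - P (s - (j + 1 : ℕ)))
        + Real.log (P (s + 1 + (j + 1 : ℕ)) - (P s + P (s + 1)) / 2)))| ≤ 1 := by
    refine (Finset.abs_sum_le_sum_abs _ _).trans
      ((Finset.sum_le_sum fun j _ => h.abs_log_sub_log_midpoint_le s j hx).trans ?_)
    rw [Finset.sum_range_sub' (fun j : ℕ => 1 / ((j : ℝ) + 1))]
    have : (0 : ℝ) ≤ 1 / ((r : ℝ) + 1) := by positivity
    simp only [Nat.cast_zero]
    linarith
  rw [ev, ew, Real.log_div hxv.ne' (by linarith), Real.log_div hxw.ne' (by linarith)]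
  rw [← abs_neg] at hsum
  rw [Finset.sum_sub_distrib] at hsum
  unfold gridLogSum
  rw [Finset.sum_range_succ', Finset.sum_range_succ' _ r]
  simp only [Nat.cast_zero, sub_zero, add_zero]
  convert hsum using 2
  ring

/-- The representative in `[0, q)` of `m * u` modulo `q`. -/
def modIndex (q : ℕ) (u m : ℤ) : ℕ := ((m * u) % q).toNat

theorem modIndex_cast {q : ℕ} (hq : 0 < q) (u m : ℤ) : (modIndex q u m : ℤ) = (m * u) % q :=
  Int.toNat_of_nonneg (Int.emod_nonneg _ (by omega))

theorem modIndex_lt {q : ℕ} (hq : 0 < q) (u m : ℤ) : modIndex q u m < q := by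
  have := Int.emod_lt_of_pos (m * u) (by omega : (0 : ℤ) < q)
  rw [← modIndex_cast hq] at this
  omega

theorem dvd_sub_of_modIndex_eq {q : ℕ} (hq : 0 < q) {u m m' : ℤ} (hu : IsCoprime (q : ℤ) u)
    (h : modIndex q u m = modIndex q u m') : (q : ℤ) ∣ m - m' := by
  have h1 : (m * u) % q = (m' * u) % q := by
    rw [← modIndex_cast hq, ← modIndex_cast hq, h]
  have h2 : (q : ℤ) ∣ (m - m') * u := by
    rw [sub_mul]
    exact Int.ModEq.dvd h1.symm
  exact hu.dvd_of_dvd_mul_right h2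

/-- The fractional parts `-iα` for `i < q`, listed in increasing order and extended periodically,
when `q * α` is close to the integer `p` and `u * p ≡ -1` modulo `q`. -/
def rotPoint (α : ℝ) (q : ℕ) (p u m : ℤ) : ℝ := m / q - modIndex q u m * (α - p / q)

section RotPoint

variable {α : ℝ} {q : ℕ} {p u : ℤ}

theorem rotPoint_eq_neg_mul_add_int (hq : 0 < q) (hu : (q : ℤ) ∣ u * p + 1) (m : ℤ) :
    ∃ k : ℤ, rotPoint α q p u m = -(modIndex q u m : ℝ) * α + k := by
  have hd : (q : ℤ) ∣ m + modIndex q u m * p := by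
    rw [modIndex_cast hq]
    have h1 : (q : ℤ) ∣ m * u - (m * u) % q := Int.dvd_self_sub_emod
    have e : m + (m * u) % q * p = m * (u * p + 1) - (m * u - (m * u) % q) * p := by ring
    rw [e]
    exact dvd_sub (hu.mul_left _) (h1.mul_right _)
  obtain ⟨k, hk⟩ := hd
  refine ⟨k, ?_⟩
  have hk' : (m : ℝ) + modIndex q u m * p = q * k := by exact_mod_cast hk
  have hq' : (q : ℝ) ≠ 0 := by exact_mod_cast hq.ne'
  unfold rotPoint
  field_simp
  linear_combination hk'

theorem isNearGrid_rotPoint (hq : 0 < q) (hα : |q * α - p| * q ≤ 1 / 100) :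
    IsNearGrid q (rotPoint α q p u) := by
  have hq' : (0 : ℝ) < q := by exact_mod_cast hq
  refine ⟨hq, fun m => ?_, fun m => ?_⟩
  · have e : q * rotPoint α q p u m - m = -(modIndex q u m * (q * α - p)) := by
      unfold rotPoint
      field_simp
      ring
    rw [e, abs_neg, abs_mul, Nat.abs_cast, mul_comm]
    have : (modIndex q u m : ℝ) ≤ q := by exact_mod_cast (modIndex_lt hq u m).le
    exact (mul_le_mul_of_nonneg_left this (abs_nonneg _)).trans hα
  · have e : modIndex q u (m + q) = modIndex q u m := by
      unfold modIndex
      rw [add_mul, Int.add_mul_emod_self_left]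
    unfold rotPoint
    rw [e]
    push_cast
    field_simp
    ring

theorem sum_range_eq_sum_modIndex (hq : 0 < q) (hu : IsCoprime (q : ℤ) u) (f : ℕ → ℝ)
    (g : ℕ → ℤ) (hg : ∀ j < q, ∀ j' < q, (q : ℤ) ∣ g j - g j' → j = j') :
    ∑ i ∈ Finset.range q, f i = ∑ j ∈ Finset.range q, f (modIndex q u (g j)) := by
  have hmaps : Set.MapsTo (fun j => modIndex q u (g j)) (Finset.range q) (Finset.range q) :=
    fun j _ => Finset.mem_coe.2 (Finset.mem_range.2 (modIndex_lt hq u _))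
  have hinj : Set.InjOn (fun j => modIndex q u (g j)) (Finset.range q) := fun j hj j' hj' h =>
    hg j (Finset.mem_range.1 hj) j' (Finset.mem_range.1 hj') (dvd_sub_of_modIndex_eq hq hu h)
  refine (Finset.sum_nbij (fun j => modIndex q u (g j)) (fun j hj => hmaps hj) hinj
    (Finset.surjOn_of_injOn_of_card_le _ hmaps hinj le_rfl) fun _ _ => rfl).symm

theorem birkhoffRot_symLog_eq (hq : 0 < q) (hα : |q * α - p| * q ≤ 1 / 100)
    (hu : (q : ℤ) ∣ u * p + 1) (s : ℤ) {x : ℝ}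
    (hx : x ∈ Set.Ioo (rotPoint α q p u s) (rotPoint α q p u (s + 1))) :
    birkhoffRot α symLog q x = -gridLogSum q (rotPoint α q p u) s x := by
  have hP := isNearGrid_rotPoint (u := u) hq hα
  have hcop : IsCoprime (q : ℤ) u := by
    obtain ⟨k, hk⟩ := hu
    exact ⟨k, -p, by linear_combination -hk⟩
  have hsmall : ∀ j < q, ∀ j' < q, (q : ℤ) ∣ (j : ℤ) - j' → j = j' := by
    intro j hj j' hj' h
    have := Int.eq_zero_of_abs_lt_dvd h (by rw [abs_lt]; omega)
    omega
  have hL : ∑ i ∈ Finset.range q, Real.log (Int.fract (x + i * α))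
      = ∑ j ∈ Finset.range q, Real.log (x - rotPoint α q p u (s - j)) := by
    rw [sum_range_eq_sum_modIndex hq hcop _ (fun j => s - j) fun j hj j' hj' h =>
      (hsmall j' hj' j hj (by simpa using h)).symm]
    refine Finset.sum_congr rfl fun j hj => ?_
    have hj := Finset.mem_range.1 hj
    obtain ⟨k, hk⟩ := rotPoint_eq_neg_mul_add_int (α := α) hq hu (s - j)
    congr 1
    rw [Int.fract_eq_iff]
    have h1 := hP.strictMono.monotone (show s - j ≤ s by omega)
    have h2 := hP.strictMono.monotone (show s + 1 ≤ s - j + q by omega)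
    rw [hP.add_period] at h2
    exact ⟨by linarith [hx.1], by linarith [hx.2], k, by linarith⟩
  have hR : ∑ i ∈ Finset.range q, Real.log (1 - Int.fract (x + i * α))
      = ∑ j ∈ Finset.range q, Real.log (rotPoint α q p u (s + 1 + j) - x) := by
    rw [sum_range_eq_sum_modIndex hq hcop _ (fun j => s + 1 + j) fun j hj j' hj' h =>
      hsmall j hj j' hj' (by simpa using h)]
    refine Finset.sum_congr rfl fun j hj => ?_
    have hj := Finset.mem_range.1 hj
    obtain ⟨k, hk⟩ := rotPoint_eq_neg_mul_add_int (α := α) hq hu (s + 1 + j)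
    congr 1
    have h1 := hP.strictMono.monotone (show s + 1 ≤ s + 1 + j by omega)
    have h2 := hP.strictMono.monotone (show s + 1 + j ≤ s + q by omega)
    rw [hP.add_period] at h2
    rw [sub_eq_iff_eq_add, eq_comm, ← eq_sub_iff_add_eq', Int.fract_eq_iff]
    exact ⟨by linarith [hx.1], by linarith [hx.2], k - 1, by push_cast; linarith⟩
  unfold birkhoffRot symLog gridLogSum
  rw [Finset.sum_sub_distrib, Finset.sum_neg_distrib, hL, hR, Finset.sum_add_distrib]
  ring

theorem exists_rotPoint_eq_of_mem_partPoints (hq : 0 < q) (hu : (q : ℤ) ∣ u * p + 1)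
    {v : ℝ} (hv : v ∈ partPoints α q) :
    ∃ s : ℤ, rotPoint α q p u s = v := by
  obtain ⟨i, hi, rfl⟩ := hv
  have hi : i < q := hi
  have hidx : modIndex q u (-(i * p)) = i := by
    have h1 : ((-(i * p) : ℤ) * u) % q = i % q := by
      refine Int.ModEq.symm ((Int.modEq_iff_dvd).2 ?_)
      rw [show -(i * p : ℤ) * u - i = -(i * (u * p + 1)) by ring]
      exact (hu.mul_left _).neg_right
    have h2 := modIndex_cast hq u (-(i * p))
    rw [h1, Int.emod_eq_of_lt (by omega) (by omega)] at h2
    exact_mod_cast h2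
  have e : modIndex q u (-(i * p) - ⌊-(i : ℝ) * α⌋ * q) = i := by
    refine Eq.trans ?_ hidx
    unfold modIndex
    congr 1
    refine (Int.modEq_iff_dvd).2 ⟨⌊-(i : ℝ) * α⌋ * u, by ring⟩
  refine ⟨-(i * p) - ⌊-(i : ℝ) * α⌋ * q, ?_⟩
  have hq' : (q : ℝ) ≠ 0 := by exact_mod_cast hq.ne'
  unfold rotPoint Int.fract
  rw [e]
  push_cast
  field_simp
  ring

theorem rotPoint_mem_partPoints (hq : 0 < q) (hu : (q : ℤ) ∣ u * p + 1) {m : ℤ}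
    (h0 : 0 ≤ rotPoint α q p u m) (h1 : rotPoint α q p u m < 1) :
    rotPoint α q p u m ∈ partPoints α q := by
  obtain ⟨k, hk⟩ := rotPoint_eq_neg_mul_add_int (α := α) hq hu m
  exact ⟨modIndex q u m, modIndex_lt hq u m,
    Int.fract_eq_iff.2 ⟨h0, h1, -k, by push_cast; linarith⟩⟩

theorem IsPartitionInterval.exists_eq_rotPoint (hq : 0 < q) (hu : (q : ℤ) ∣ u * p + 1)
    (hα : |q * α - p| * q ≤ 1 / 100) {v w : ℝ} (h : IsPartitionInterval α q v w) :
    ∃ s : ℤ, v = rotPoint α q p u s ∧ w = rotPoint α q p u (s + 1) := by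
  obtain ⟨hv, hw, hvw, hgap⟩ := h
  have hP := isNearGrid_rotPoint (u := u) hq hα
  have hv0 : 0 ≤ v := by
    obtain ⟨i, -, rfl⟩ := hv
    exact Int.fract_nonneg _
  have hw1 : w ≤ 1 := by
    rcases hw with ⟨i, -, rfl⟩ | rfl
    · exact (Int.fract_lt_one _).le
    · exact le_rfl
  have hwt : ∃ t : ℤ, rotPoint α q p u t = w := by
    rcases hw with hw | rfl
    · exact exists_rotPoint_eq_of_mem_partPoints hq hu hw
    · exact ⟨0 + q, by rw [hP.add_period]; simp [rotPoint, modIndex]⟩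
  obtain ⟨s, rfl⟩ := exists_rotPoint_eq_of_mem_partPoints hq hu hv
  obtain ⟨t, rfl⟩ := hwt
  have hst : s < t := hP.strictMono.lt_iff_lt.1 hvw
  refine ⟨s, rfl, ?_⟩
  by_contra hne
  have h1 : s + 1 < t := lt_of_le_of_ne hst fun h => hne (by rw [← h])
  have h2 := hP.strictMono (lt_add_one s)
  have h3 := hP.strictMono h1
  exact hgap _ (rotPoint_mem_partPoints hq hu (by linarith) (by linarith)) ⟨h2, h3⟩

end RotPoint

theorem gaussIter_irrational {α : ℝ} (hirr : Irrational α) (n : ℕ) :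
    Irrational (gaussIter α n) ∧ gaussIter α n ∈ Set.Ioo (0 : ℝ) 1 := by
  have key : ∀ x : ℝ, Irrational x → Irrational (Int.fract x) ∧ Int.fract x ∈ Set.Ioo (0 : ℝ) 1 := by
    intro x hx
    have h : Irrational (Int.fract x) := by
      unfold Int.fract
      exact hx.sub_intCast _
    exact ⟨h, lt_of_le_of_ne (Int.fract_nonneg x) h.ne_zero.symm, Int.fract_lt_one x⟩
  induction n with
  | zero => exact key α hirr
  | succ n ih =>
    unfold gaussIter at ih ⊢
    rw [Function.iterate_succ_apply']
    exact key _ ih.1.inv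

theorem gaussIter_succ_eq {α : ℝ} (hirr : Irrational α) (n : ℕ) :
    gaussIter α (n + 1) = (gaussIter α n)⁻¹ - cfA α (n + 1) := by
  have h0 : 0 ≤ (gaussIter α n)⁻¹ := inv_nonneg.2 (gaussIter_irrational hirr n).2.1.le
  have h1 : gaussIter α (n + 1) = Int.fract (gaussIter α n)⁻¹ := by
    unfold gaussIter
    rw [Function.iterate_succ_apply']
  rw [h1, cfA, Nat.add_sub_cancel, natCast_floor_eq_intCast_floor h0]
  rfl

theorem cfQ_pos {α : ℝ} (hirr : Irrational α) (n : ℕ) : 0 < cfQ α n := by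
  have ha : ∀ n, 0 < cfA α (n + 1) := fun n => by
    have h := (gaussIter_irrational hirr n).2
    exact Nat.floor_pos.2 ((one_le_inv₀ h.1).2 h.2.le)
  have key : 0 < cfQ α n ∧ 0 < cfQ α (n + 1) := by
    induction n with
    | zero => exact ⟨one_pos, ha 0⟩
    | succ n ih => exact ⟨ih.2, Nat.add_pos_right _ ih.1⟩
  exact key.1

theorem cfA_mul_cfQ_le (α : ℝ) (n : ℕ) : cfA α (n + 1) * cfQ α n ≤ cfQ α (n + 1) := by
  cases n with
  | zero => exact (mul_one _).le
  | succ n => exact Nat.le_add_right _ _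

/-- Two consecutive convergents: the errors `q α - p` shrink by the Gauss iterate, and the numerators
and denominators form a unimodular matrix. -/
theorem exists_convergents {α : ℝ} (hirr : Irrational α) (hα : α ∈ Set.Ioo (0 : ℝ) 1) (n : ℕ) :
    ∃ p p' : ℤ, cfQ α (n + 1) * α - p' = -gaussIter α (n + 1) * (cfQ α n * α - p) ∧
      |p' * cfQ α n - p * cfQ α (n + 1)| = 1 := by
  induction n with
  | zero =>
    have h0 : gaussIter α 0 = α := Int.fract_eq_self.2 ⟨hα.1.le, hα.2⟩
    refine ⟨0, 1, ?_, by simp [cfQ]⟩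
    have := gaussIter_succ_eq hirr 0
    rw [this, h0]
    have : α ≠ 0 := hα.1.ne'
    simp only [cfQ, zero_add]
    push_cast
    field_simp
    ring
  | succ n ih =>
    obtain ⟨p, p', h, hdet⟩ := ih
    refine ⟨p', cfA α (n + 2) * p' + p, ?_, ?_⟩
    · have hx := (gaussIter_irrational hirr (n + 1)).2.1.ne'
      have hs : gaussIter α (n + 2) = (gaussIter α (n + 1))⁻¹ - cfA α (n + 2) :=
        gaussIter_succ_eq hirr (n + 1)
      rw [show n + 1 + 1 = n + 2 from rfl, hs]
      simp only [cfQ]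
      push_cast
      have h' : (gaussIter α (n + 1))⁻¹ * (cfQ α (n + 1) * α - p') = -(cfQ α n * α - p) := by
        rw [h]
        field_simp
      linear_combination h'
    · rw [← hdet, ← abs_neg]
      simp only [cfQ]
      push_cast
      congr 1
      ring

theorem exists_coprime_abs_cfQ_mul_sub_le {α : ℝ} (hirr : Irrational α)
    (hα : α ∈ Set.Ioo (0 : ℝ) 1) (n : ℕ) :
    ∃ p : ℤ, IsCoprime p (cfQ α n) ∧ |cfQ α n * α - p| * cfQ α (n + 1) ≤ 1 := by
  obtain ⟨p, p', h, hdet⟩ := exists_convergents hirr hα n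
  refine ⟨p, ?_, ?_⟩
  · rcases (abs_eq zero_le_one).1 hdet with h1 | h1
    · exact ⟨-cfQ α (n + 1), p', by linear_combination h1⟩
    · exact ⟨cfQ α (n + 1), -p', by linear_combination -h1⟩
  · have hx := (gaussIter_irrational hirr (n + 1)).2.1
    have hdet' : |(p' : ℝ) * cfQ α n - p * cfQ α (n + 1)| = 1 := by exact_mod_cast hdet
    have e : (p' : ℝ) * cfQ α n - p * cfQ α (n + 1)
        = (cfQ α n * α - p) * (cfQ α (n + 1) + gaussIter α (n + 1) * cfQ α n) := by
      linear_combination -(cfQ α n : ℝ) * h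
    rw [e, abs_mul] at hdet'
    rw [← hdet']
    refine mul_le_mul_of_nonneg_left (le_trans ?_ (le_abs_self _)) (abs_nonneg _)
    have : 0 ≤ gaussIter α (n + 1) * cfQ α n := by positivity
    linarith

/-- For `α ∈ 𝒞_{K,L}` (`L > K`) with associated sequence `(n_k)` and
`h(x) = -log x - log(1-x)`: there exists `C'''' > 0` such that for every `k`, every
partition interval `I_s = (v_s, w_s)` of `𝕋` by `{-iα}_{i<q_{n_k}}` and every `x ∈ I_s`:
`|S_{q_{n_k}}(h)(x) - S_{q_{n_k}}(h)(y_s) + log(2(x-v_s)/|I_s|) + log(2(w_s-x)/|I_s|)|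
  ≤ C''''`, with `y_s` the midpoint of `I_s` and `|I_s| = w_s - v_s`. -/
theorem statement17 (K L : ℕ) (hKL : K < L)
    (α : ℝ) (hirr : Irrational α) (hα : α ∈ Set.Ioo (0 : ℝ) 1)
    (nk : ℕ → ℕ) (hnk : StrictMono nk) (c : ℝ) (hc : 0 < c)
    (hdio1 : ∀ k n : ℕ, 1 ≤ n → n ≤ nk k →
      (cfA α (nk k + 1 - n) : ℝ) ≤ Real.exp (c * n))
    (hdio2 : ∀ k : ℕ, 100 * (K ^ 2 + L ^ 2) < cfA α (nk k + 1) ∧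
      cfA α (nk k + 1) < 200 * (K ^ 2 + L ^ 2)) :
    ∃ C4 > (0 : ℝ), ∀ k : ℕ, ∀ v w : ℝ,
      IsPartitionInterval α (cfQ α (nk k)) v w →
      ∀ x ∈ Set.Ioo v w,
        |birkhoffRot α symLog (cfQ α (nk k)) x
            - birkhoffRot α symLog (cfQ α (nk k)) ((v + w) / 2)
            + Real.log (2 * (x - v) / (w - v))
            + Real.log (2 * (w - x) / (w - v))|
          ≤ C4 := by
  have hpos : 0 < K ^ 2 + L ^ 2 := by
    have : 0 < L := by omega
    positivity
  refine ⟨1, one_pos, fun k v w hI x hx => ?_⟩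
  have hq := cfQ_pos hirr (nk k)
  obtain ⟨p, ⟨a, b, hab⟩, hp⟩ := exists_coprime_abs_cfQ_mul_sub_le hirr hα (nk k)
  have hu : (cfQ α (nk k) : ℤ) ∣ -a * p + 1 := ⟨b, by linear_combination -hab⟩
  have hnear : |cfQ α (nk k) * α - p| * cfQ α (nk k) ≤ 1 / 100 := by
    have h1 : 100 * cfQ α (nk k) ≤ cfQ α (nk k + 1) :=
      (Nat.mul_le_mul_right _ (by have := (hdio2 k).1; omega)).trans (cfA_mul_cfQ_le α (nk k))
    have h2 : (100 : ℝ) * cfQ α (nk k) ≤ cfQ α (nk k + 1) := by exact_mod_cast h1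
    linarith [mul_le_mul_of_nonneg_left h2 (abs_nonneg (cfQ α (nk k) * α - p))]
  obtain ⟨s, rfl, rfl⟩ := hI.exists_eq_rotPoint hq hu hnear
  have hvw := hx.1.trans hx.2
  rw [birkhoffRot_symLog_eq hq hnear hu s hx,
    birkhoffRot_symLog_eq hq hnear hu s ⟨by linarith, by linarith⟩, sub_neg_eq_add]
  exact (isNearGrid_rotPoint hq hnear).abs_gridLogSum_sub_le s hx
end
end
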